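/- Let K, L ⊊ H² be proper closed convex sets with nonempty interior such that for all orientation-preserving congruences φ, ψ of H² with int((φK) ∩ (ψL)) ≠ ∅, the set (φK) ∩ (ψL) admits some non-trivial congruence. Suppose K is a paracircle and the connected boundary components of L are at least two hypercycles or straight lines. Then case (D) holds: L is the parallel domain of some straight line at some distance l > 0. -/

import Mathlib

open Metric Set Filter

namespace BallChar

/-- `X` is (isometric to) the `d`-dimensional round sphere of radius 1,
with the intrinsic (great-circle) metric. -/
def IsSphereSpace (X : Type*) [MetricSpace X] (d : ℕ) : Prop :=
  ∃ e : X → EuclideanSpace ℝ (Fin (d + 1)),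
    Function.Injective e ∧
    Set.range e = Metric.sphere (0 : EuclideanSpace ℝ (Fin (d + 1))) 1 ∧
    ∀ x y : X, dist x y = Real.arccos (@inner ℝ _ _ (e x) (e y))

/-- `X` is (isometric to) the `d`-dimensional Euclidean space. -/
def IsEuclideanSpaceForm (X : Type*) [MetricSpace X] (d : ℕ) : Prop :=
  Nonempty (X ≃ᵢ EuclideanSpace ℝ (Fin d))

/-- The Minkowski bilinear form on `ℝ^d × ℝ`. -/
noncomputable def mink (d : ℕ) (u v : EuclideanSpace ℝ (Fin d) × ℝ) : ℝ :=
  @inner ℝ _ _ u.1 v.1 - u.2 * v.2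

/-- `X` is (isometric to) the `d`-dimensional hyperbolic space of curvature `-1`
(the hyperboloid model). -/
def IsHyperbolicSpace (X : Type*) [MetricSpace X] (d : ℕ) : Prop :=
  ∃ e : X → EuclideanSpace ℝ (Fin d) × ℝ,
    Function.Injective e ∧
    Set.range e = {u | mink d u u = -1 ∧ 0 < u.2} ∧
    ∀ x y : X, Real.cosh (dist x y) = - mink d (e x) (e y)

/-- `X` is `S^d`, `ℝ^d` or `H^d`. -/
def IsSpaceForm (X : Type*) [MetricSpace X] (d : ℕ) : Prop :=
  IsSphereSpace X d ∨ IsEuclideanSpaceForm X d ∨ IsHyperbolicSpace X d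

variable {X : Type*} [MetricSpace X]

/-- Metric betweenness: `z` lies on a shortest geodesic from `x` to `y`. -/
def Btw (x z y : X) : Prop := dist x z + dist z y = dist x y

/-- `z` is the unique point between `x` and `y` at its distance from `x`. -/
def UniqueBtwPt (x z y : X) : Prop :=
  Btw x z y ∧ ∀ w, Btw x w y → dist x w = dist x z → w = z

/-- Geodesic convexity (for two antipodal points of a sphere no condition is imposed). -/
def GConvex (K : Set X) : Prop :=
  ∀ x ∈ K, ∀ y ∈ K, ∀ z, UniqueBtwPt x z y → z ∈ K

/-- `p` is a (metric) midpoint of `x` and `y`. -/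
def IsMidpoint (p x y : X) : Prop := Btw x p y ∧ dist x p = dist p y

/-- A reflection in a hyperplane: a non-trivial involutive isometry whose
non-fixed locus is disconnected (by the mirror hyperplane). -/
def IsReflection (σ : X ≃ᵢ X) : Prop :=
  σ.trans σ = IsometryEquiv.refl X ∧ σ ≠ IsometryEquiv.refl X ∧
    ¬ IsPreconnected {x : X | σ x ≠ x}

/-- An orientation preserving congruence: a product of an even number of reflections. -/
def OrientationPreserving (f : X ≃ᵢ X) : Prop :=
  ∃ l : List (X ≃ᵢ X), (∀ σ ∈ l, IsReflection σ) ∧ Even l.length ∧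
    f = l.foldr IsometryEquiv.trans (IsometryEquiv.refl X)

/-- Two subsets are congruent if some isometry of the space maps one onto the other. -/
def Congruent (A B : Set X) : Prop := ∃ f : X ≃ᵢ X, ⇑f '' A = B

/-- `S` admits some non-trivial congruence. -/
def AdmitsNontrivialCongruence (S : Set X) : Prop :=
  ∃ f : X ≃ᵢ X, f ≠ IsometryEquiv.refl X ∧ ⇑f '' S = S

/-- `S` is axially symmetric (symmetric with respect to some reflection). -/
def AxiallySymmetric (S : Set X) : Prop :=
  ∃ σ : X ≃ᵢ X, IsReflection σ ∧ ⇑σ '' S = S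

/-- `S` is centrally symmetric: some involutive isometry fixing a point `p`
maps `S` onto itself, `p` being a midpoint of every pair `x`, `σ x` of `S`. -/
def CentrallySymmetric (S : Set X) : Prop :=
  ∃ (σ : X ≃ᵢ X) (p : X), Function.Involutive ⇑σ ∧ σ p = p ∧ ⇑σ '' S = S ∧
    ∀ x ∈ S, IsMidpoint p x (σ x)

/-- `S` is symmetric with respect to the orthogonal bisector hyperplane of
the segment `[a, b]`, i.e. invariant under the reflection interchanging `a` and `b`. -/
def SymmetricWrtPerpBisector (S : Set X) (a b : X) : Prop :=
  ∃ σ : X ≃ᵢ X, IsReflection σ ∧ σ a = b ∧ ⇑σ '' S = S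

/-- A closed half-space: one of the two closed sides of the mirror of a reflection. -/
def IsHalfspace (P : Set X) : Prop :=
  ∃ σ : X ≃ᵢ X, IsReflection σ ∧ IsClosed P ∧
    P ∪ ⇑σ '' P = univ ∧ P ∩ ⇑σ '' P = {x | σ x = x}

/-- A hyperplane: the mirror (fixed point set) of a reflection. -/
def IsHyperplane (B : Set X) : Prop :=
  ∃ σ : X ≃ᵢ X, IsReflection σ ∧ B = {x | σ x = x}

/-- A paraball (horoball): a sublevel set of a Busemann function. -/
def IsParaball (K : Set X) : Prop :=
  ∃ γ : ℝ → X, Isometry γ ∧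
    K = {x | ∃ b ≤ 0, Tendsto (fun t => dist x (γ t) - t) atTop (nhds b)}

/-- A parasphere (horosphere): the boundary of a paraball. -/
def IsParasphere (C : Set X) : Prop := ∃ K : Set X, IsParaball K ∧ C = frontier K

/-- A hypersphere at distance `lam > 0` from its base hyperplane
(degeneration to a hyperplane excluded). -/
def IsHypersphere (C : Set X) (lam : ℝ) : Prop :=
  0 < lam ∧ (∃ P : Set X, IsHalfspace P ∧ C = frontier {x | infDist x P ≤ lam}) ∧
    ¬ IsHyperplane C

/-- The family of connected components of the boundary of `K`. -/
def bdryComponents (K : Set X) : Set (Set X) :=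
  (connectedComponentIn (frontier K)) '' (frontier K)

/-- `closedBall p r` is an inball of `M` (a ball of maximal radius contained in `M`). -/
def IsInball (M : Set X) (p : X) (r : ℝ) : Prop :=
  0 ≤ r ∧ closedBall p r ⊆ M ∧ ∀ (q : X) (s : ℝ), closedBall q s ⊆ M → s ≤ r

/-- `closedBall p r` is the unique inball of `M`. -/
def HasUniqueInball (M : Set X) (p : X) (r : ℝ) : Prop :=
  IsInball M p r ∧ ∀ (q : X) (s : ℝ), IsInball M q s → q = p

/-- The (geodesic) convex hull of a set. -/
def gconvexHull (Y : Set X) : Set X := ⋂₀ {C : Set X | GConvex C ∧ Y ⊆ C}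

/-- `z` lies on the complete geodesic line through `a` and `b`. -/
def OnLine (a b z : X) : Prop := Btw a z b ∨ Btw z a b ∨ Btw a b z

/-- The closed `(d-1)`-ball of radius `ε` centred at `a` in the hyperplane through `a`
orthogonal to the segment `[a, b]`. -/
def perpDisc (a b : X) (ε : ℝ) : Set X :=
  {x | (∀ z, OnLine a b z → dist x a ≤ dist x z) ∧ dist x a ≤ ε}

/-- The set `D(ε)` associated to the segment `D = [a, b]`: the convex hull of the two
`(d-1)`-balls of radius `ε` orthogonal to `D` at its endpoints. -/
def segCyl (a b : X) (ε : ℝ) : Set X :=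
  gconvexHull (perpDisc a b ε ∪ perpDisc b a ε)

/-- `[a, b]` is the unique diametral segment of `M`. -/
def UniqueDiametral (M : Set X) (a b : X) : Prop :=
  a ∈ M ∧ b ∈ M ∧ a ≠ b ∧ dist a b = diam M ∧
    ∀ a' ∈ M, ∀ b' ∈ M, dist a' b' = diam M → (a' = a ∧ b' = b) ∨ (a' = b ∧ b' = a)

/-- Condition (**): at every boundary point, `K` contains a ball having this point
on its boundary. -/
def CondBallInside (K : Set X) : Prop :=
  ∀ x ∈ frontier K, ∃ ε > 0, ∃ p : X, closedBall p ε ⊆ K ∧ x ∈ sphere p ε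

/-- `K` has an extreme point. -/
def HasExtremePoint (K : Set X) : Prop :=
  ∃ x ∈ K, ∀ y ∈ K, ∀ z ∈ K, Btw y x z → x = y ∨ x = z

/-- Condition (***): near every boundary point, `K` is contained in a ball
(resp. in a convex set bounded by a hypersphere, for hyperbolic space) whose boundary
has sectional curvatures bounded below and passes through the given point. -/
def CondCurvBound (d : ℕ) (K : Set X) : Prop :=
  ∀ x ∈ frontier K, ∃ ε > 0, ∃ B : Set X,
    {y | y ∈ K ∧ dist y x ≤ ε} ⊆ B ∧ x ∈ frontier B ∧
    (IsSphereSpace X d → ∃ (q : X) (R : ℝ), 0 < R ∧ R < Real.pi / 2 ∧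
        ε ≤ Real.cos R / Real.sin R ∧ B = closedBall q R) ∧
    (IsEuclideanSpaceForm X d → ∃ (q : X) (R : ℝ), 0 < R ∧ ε ≤ 1 / R ∧ B = closedBall q R) ∧
    (IsHyperbolicSpace X d → ∃ (P : Set X) (lam : ℝ), IsHalfspace P ∧ 0 < lam ∧
        ε ≤ Real.tanh lam ∧ B = {y | infDist y P ≤ lam})

/-- `K` has a supporting sphere at each of its boundary points
(for the sphere, of radius less than `π/2`). -/
def SupportingSpheres (d : ℕ) (K : Set X) : Prop :=
  ∀ x ∈ frontier K, ∃ (p : X) (R : ℝ), 0 < R ∧ K ⊆ closedBall p R ∧ x ∈ sphere p R ∧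
    (IsSphereSpace X d → R < Real.pi / 2)

/-- `K` is `C¹` (smooth): at each boundary point there is a unique supporting half-space. -/
def SmoothBody (K : Set X) : Prop :=
  ∀ x ∈ frontier K, ∃! P : Set X, IsHalfspace P ∧ K ⊆ P ∧ x ∈ frontier P

/-- A complete geodesic (straight line). -/
def IsGeodesicLine (B : Set X) : Prop := ∃ γ : ℝ → X, Isometry γ ∧ B = Set.range γ

/-- A circle (closed disc) of positive radius. -/
def IsDisc (K : Set X) : Prop := ∃ (p : X) (r : ℝ), 0 < r ∧ K = closedBall p r

/-- The parallel domain of `B` at distance `l`. -/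
def parallelDomain (B : Set X) (l : ℝ) : Set X := {x | infDist x B ≤ l}

/-- `K` is the parallel domain of some straight line, at some distance `l > 0`. -/
def IsParallelDomain (K : Set X) : Prop :=
  ∃ (B : Set X) (l : ℝ), IsGeodesicLine B ∧ 0 < l ∧ K = parallelDomain B l

/-- A convex domain bounded by a (proper) hypercycle. -/
def IsHypercycleDomain (K : Set X) : Prop :=
  ∃ (P : Set X) (l : ℝ), IsHalfspace P ∧ 0 < l ∧ K = {x | infDist x P ≤ l}

/-- `C` is a hypercycle or a straight line (a curve at constant distance `l ≥ 0`
from its base line). -/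
def IsHypercycleOrLine (C : Set X) : Prop :=
  ∃ (P : Set X) (l : ℝ), IsHalfspace P ∧ 0 ≤ l ∧ C = frontier {x | infDist x P ≤ l}

/-- `C` is a hypercycle (or straight line) with base line `B`. -/
def HypercycleWithBase (C B : Set X) : Prop :=
  ∃ (P : Set X) (l : ℝ), IsHalfspace P ∧ 0 ≤ l ∧ frontier P = B ∧
    C = frontier {x | infDist x P ≤ l}

/-! Cases (A)-(E) of Theorem 5 (hyperbolic plane). -/

/-- One of the basic bodies of case (A). -/
def CaseABody (K : Set X) : Prop :=
  IsDisc K ∨ IsParaball K ∨ IsHypercycleDomain K ∨ IsHalfspace K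

/-- Case (A) of Theorem 5. -/
def CaseA (K L : Set X) : Prop :=
  CaseABody K ∧ CaseABody L ∧
    ((IsHypercycleDomain K ∨ IsHalfspace K) → IsDisc L ∨ Congruent K L) ∧
    ((IsHypercycleDomain L ∨ IsHalfspace L) → IsDisc K ∨ Congruent L K)

/-- `M` is bounded either by two hypercycles whose base lines coincide, or by a
hypercycle and its base line. -/
def TwoHypSameBase (M : Set X) : Prop :=
  ∃ (B C₁ C₂ : Set X), IsGeodesicLine B ∧ C₁ ≠ C₂ ∧
    HypercycleWithBase C₁ B ∧ HypercycleWithBase C₂ B ∧ frontier M = C₁ ∪ C₂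

/-- Case (B) of Theorem 5. -/
def CaseB (K L : Set X) : Prop :=
  (IsDisc K ∧ TwoHypSameBase L) ∨ (IsDisc L ∧ TwoHypSameBase K)

/-- `M` is bounded by at least two hypercycles or straight lines, with all base lines
different, whose mutual distances are at least `2r`. -/
def MultiHypFarApart (M : Set X) (r : ℝ) : Prop :=
  (∀ x ∈ frontier M, IsHypercycleOrLine (connectedComponentIn (frontier M) x)) ∧
  (∃ x ∈ frontier M, ∃ y ∈ frontier M,
      connectedComponentIn (frontier M) x ≠ connectedComponentIn (frontier M) y) ∧
  (∀ x ∈ frontier M, ∀ y ∈ frontier M,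
      connectedComponentIn (frontier M) x ≠ connectedComponentIn (frontier M) y →
        2 * r ≤ dist x y ∧
        ∀ B₁ B₂ : Set X, HypercycleWithBase (connectedComponentIn (frontier M) x) B₁ →
          HypercycleWithBase (connectedComponentIn (frontier M) y) B₂ → B₁ ≠ B₂)

/-- Case (C) of Theorem 5. -/
def CaseC (K L : Set X) : Prop :=
  (∃ (p : X) (r : ℝ), 0 < r ∧ K = closedBall p r ∧ MultiHypFarApart L r) ∨
  (∃ (p : X) (r : ℝ), 0 < r ∧ L = closedBall p r ∧ MultiHypFarApart K r)

/-- Case (D) of Theorem 5. -/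
def CaseD (K L : Set X) : Prop :=
  (IsParaball K ∧ IsParallelDomain L) ∨ (IsParaball L ∧ IsParallelDomain K)

/-- Case (E) of Theorem 5. -/
def CaseE (K L : Set X) : Prop :=
  Congruent K L ∧ IsParallelDomain K ∧ IsParallelDomain L

/-- All cases of (3) of Theorem 5 together. -/
def Theorem5Cases (K L : Set X) : Prop :=
  CaseA K L ∨ CaseB K L ∨ CaseC K L ∨ CaseD K L ∨ CaseE K L

/-- Condition (1) of Theorem 5: every intersection of congruent copies admits some
non-trivial congruence. -/
def T5Cond1 (K L : Set X) : Prop :=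
  ∀ φ ψ : X ≃ᵢ X, OrientationPreserving φ → OrientationPreserving ψ →
    (interior ((⇑φ '' K) ∩ (⇑ψ '' L))).Nonempty →
    AdmitsNontrivialCongruence ((⇑φ '' K) ∩ (⇑ψ '' L))

/-- Condition (2) of Theorem 5: every intersection of congruent copies is axially
symmetric. -/
def T5Cond2 (K L : Set X) : Prop :=
  ∀ φ ψ : X ≃ᵢ X, OrientationPreserving φ → OrientationPreserving ψ →
    (interior ((⇑φ '' K) ∩ (⇑ψ '' L))).Nonempty →
    AxiallySymmetric ((⇑φ '' K) ∩ (⇑ψ '' L))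

/-- All connected components of the boundary of `K` are hypercycles or straight lines. -/
def BdryHypOrLine (K : Set X) : Prop :=
  ∀ x ∈ frontier K, IsHypercycleOrLine (connectedComponentIn (frontier K) x)

/-- The boundary of `K` has at least two connected components. -/
def AtLeastTwoComponents (K : Set X) : Prop :=
  ∃ x ∈ frontier K, ∃ y ∈ frontier K,
    connectedComponentIn (frontier K) x ≠ connectedComponentIn (frontier K) y

/-- The boundary of `K` is nonempty and has a single connected component. -/
def SingleComponent (K : Set X) : Prop :=
  (frontier K).Nonempty ∧ ∀ x ∈ frontier K, ∀ y ∈ frontier K,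
    connectedComponentIn (frontier K) x = connectedComponentIn (frontier K) y

/-- The associated graph of `K` contains two edges with at least one common endpoint:
`K` has two distinct boundary components which are asymptotic (come arbitrarily close). -/
def TwoAsymptoticComponents (K : Set X) : Prop :=
  ∃ x ∈ frontier K, ∃ y ∈ frontier K,
    connectedComponentIn (frontier K) x ≠ connectedComponentIn (frontier K) y ∧
    ∀ δ > (0 : ℝ), ∃ p ∈ connectedComponentIn (frontier K) x,
      ∃ q ∈ connectedComponentIn (frontier K) y, dist p q < δ

/-- The associated graph of `K` has only pairwise vertex-disjoint edges: distinct
boundary components of `K` stay at positive distance from each other. -/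
def VertexDisjointEdges (K : Set X) : Prop :=
  ∀ x ∈ frontier K, ∀ y ∈ frontier K,
    connectedComponentIn (frontier K) x ≠ connectedComponentIn (frontier K) y →
      ∃ δ > (0 : ℝ), ∀ p ∈ connectedComponentIn (frontier K) x,
        ∀ q ∈ connectedComponentIn (frontier K) y, δ ≤ dist p q

/-! Conditions of Theorem 6. -/

/-- Condition (1) of Theorem 6. -/
def T6Cond1 (K L : Set X) : Prop :=
  ∃ ε > (0 : ℝ), ∀ φ ψ : X ≃ᵢ X, OrientationPreserving φ → OrientationPreserving ψ →
    (interior ((⇑φ '' K) ∩ (⇑ψ '' L))).Nonempty →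
    diam ((⇑φ '' K) ∩ (⇑ψ '' L)) < ε →
    CentrallySymmetric ((⇑φ '' K) ∩ (⇑ψ '' L))

/-- Condition (2) of Theorem 6. -/
def T6Cond2 (K L : Set X) : Prop :=
  ∀ x ∈ frontier K, ∀ y ∈ frontier L, ∃ ε > (0 : ℝ),
    ∀ φ ψ : X ≃ᵢ X, OrientationPreserving φ → OrientationPreserving ψ →
      (interior ((⇑φ '' K) ∩ (⇑ψ '' L))).Nonempty →
      diam ((⇑φ '' K) ∩ (⇑ψ '' L)) < ε →
      ∀ (p : X) (r : ℝ), HasUniqueInball ((⇑φ '' K) ∩ (⇑ψ '' L)) p r →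
        frontier ((⇑φ '' K) ∩ (⇑ψ '' L)) ∩ sphere p r = {φ x, ψ y} →
        φ x ∈ interior (⇑ψ '' L) → ψ y ∈ interior (⇑φ '' K) →
        IsMidpoint p (φ x) (ψ y) →
        CentrallySymmetric ((⇑φ '' K) ∩ (⇑ψ '' L))

/-- Condition (3) of Theorem 6. -/
def T6Cond3 (K L : Set X) : Prop :=
  ∀ x ∈ frontier K, ∀ y ∈ frontier L, ∃ ε > (0 : ℝ),
    ∀ φ ψ : X ≃ᵢ X, OrientationPreserving φ → OrientationPreserving ψ →
      (interior ((⇑φ '' K) ∩ (⇑ψ '' L))).Nonempty →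
      diam ((⇑φ '' K) ∩ (⇑ψ '' L)) < ε →
      ∀ (p : X) (r : ℝ), HasUniqueInball ((⇑φ '' K) ∩ (⇑ψ '' L)) p r →
        frontier ((⇑φ '' K) ∩ (⇑ψ '' L)) ∩ sphere p r = {φ x, ψ y} →
        φ x ∈ interior (⇑ψ '' L) → ψ y ∈ interior (⇑φ '' K) →
        IsMidpoint p (φ x) (ψ y) →
        SymmetricWrtPerpBisector ((⇑φ '' K) ∩ (⇑ψ '' L)) (φ x) (ψ y)

/-- Condition (4) of Theorem 6. -/
def T6Cond4 (d : ℕ) (K L : Set X) : Prop :=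
  (∃ r > (0 : ℝ), (IsSphereSpace X d → r ≤ Real.pi / 2) ∧
      (∀ C ∈ bdryComponents K ∪ bdryComponents L, ∃ p : X, C = sphere p r) ∧
      (∃ p : X, K = closedBall p r) ∧ ∃ q : X, L = closedBall q r) ∨
  ((∀ C ∈ bdryComponents K ∪ bdryComponents L, IsParasphere C) ∧
      IsParaball K ∧ IsParaball L) ∨
  (∃ lam > (0 : ℝ), ∀ C ∈ bdryComponents K ∪ bdryComponents L, IsHypersphere C lam)

/-! Conditions of Theorems 7 and 8. -/

/-- The pair `φ, ψ` is admissible for hypothesis (****): both are orientation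
preserving, and for the sphere `(φ K) ∪ (ψ L)` lies in an open hemisphere. -/
def GoodPair (d : ℕ) (K L : Set X) (φ ψ : X ≃ᵢ X) : Prop :=
  OrientationPreserving φ ∧ OrientationPreserving ψ ∧
    (IsSphereSpace X d → ∃ s : X, (⇑φ '' K) ∪ (⇑ψ '' L) ⊆ ball s (Real.pi / 2))

/-- The convex hull of the union of the two congruent copies. -/
def hullUnion (K L : Set X) (φ ψ : X ≃ᵢ X) : Set X := gconvexHull ((⇑φ '' K) ∪ (⇑ψ '' L))

/-- Condition (A) of (3) of Theorem 7: the diameter of `M` is sufficiently close to `π`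
(sphere), resp. sufficiently large (Euclidean, hyperbolic), as measured by `δ`. -/
def BigDiam (d : ℕ) (X : Type*) [MetricSpace X] (M : Set X) (δ : ℝ) : Prop :=
  (IsSphereSpace X d → Real.pi - δ < diam M) ∧ (¬ IsSphereSpace X d → 1 / δ < diam M)

/-- Condition (1) of Theorem 7. -/
def T7Cond1 (d : ℕ) (K L : Set X) : Prop :=
  ∀ φ ψ : X ≃ᵢ X, GoodPair d K L φ ψ → CentrallySymmetric (hullUnion K L φ ψ)

/-- Condition (2) of Theorem 7. -/
def T7Cond2 (d : ℕ) (K L : Set X) : Prop :=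
  ∀ φ ψ : X ≃ᵢ X, GoodPair d K L φ ψ → ∀ a b : X, UniqueDiametral (hullUnion K L φ ψ) a b →
    SymmetricWrtPerpBisector (hullUnion K L φ ψ) a b

/-- Condition (3) of Theorem 7. -/
def T7Cond3 (d : ℕ) (K L : Set X) : Prop :=
  ∃ δ > (0 : ℝ), ∀ φ ψ : X ≃ᵢ X, GoodPair d K L φ ψ →
    ∀ x ∈ frontier K, ∀ y ∈ frontier L,
      BigDiam d X (hullUnion K L φ ψ) δ →
      UniqueDiametral (hullUnion K L φ ψ) (φ x) (ψ y) →
      CentrallySymmetric (hullUnion K L φ ψ)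

/-- Condition (4) of Theorem 7. -/
def T7Cond4 (d : ℕ) (K L : Set X) : Prop :=
  ∃ δ > (0 : ℝ), ∀ φ ψ : X ≃ᵢ X, GoodPair d K L φ ψ →
    ∀ x ∈ frontier K, ∀ y ∈ frontier L,
      BigDiam d X (hullUnion K L φ ψ) δ →
      UniqueDiametral (hullUnion K L φ ψ) (φ x) (ψ y) →
      SymmetricWrtPerpBisector (hullUnion K L φ ψ) (φ x) (ψ y)

/-- Condition (5) of Theorem 7. -/
def T7Cond5 (d : ℕ) (K L : Set X) : Prop :=
  ∃ δ > (0 : ℝ), ∀ φ ψ : X ≃ᵢ X, GoodPair d K L φ ψ →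
    ∀ x ∈ frontier K, ∀ y ∈ frontier L,
      BigDiam d X (hullUnion K L φ ψ) δ →
      UniqueDiametral (hullUnion K L φ ψ) (φ x) (ψ y) →
      ∃ ε₀ > (0 : ℝ), ∀ ε : ℝ, 0 < ε → ε < ε₀ →
        (IsSphereSpace X d → ∃ s : X, (⇑φ '' K) ∪ (⇑ψ '' L) ⊆ ball s (Real.pi / 2) ∧
            segCyl (φ x) (ψ y) ε ⊆ ball s (Real.pi / 2)) ∧
        CentrallySymmetric (hullUnion K L φ ψ ∩ segCyl (φ x) (ψ y) ε)

/-- Condition (6) of Theorem 7. -/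
def T7Cond6 (d : ℕ) (K L : Set X) : Prop :=
  ∃ δ > (0 : ℝ), ∀ φ ψ : X ≃ᵢ X, GoodPair d K L φ ψ →
    ∀ x ∈ frontier K, ∀ y ∈ frontier L,
      BigDiam d X (hullUnion K L φ ψ) δ →
      UniqueDiametral (hullUnion K L φ ψ) (φ x) (ψ y) →
      ∃ ε₀ > (0 : ℝ), ∀ ε : ℝ, 0 < ε → ε < ε₀ →
        (IsSphereSpace X d → ∃ s : X, (⇑φ '' K) ∪ (⇑ψ '' L) ⊆ ball s (Real.pi / 2) ∧
            segCyl (φ x) (ψ y) ε ⊆ ball s (Real.pi / 2)) ∧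
        SymmetricWrtPerpBisector (hullUnion K L φ ψ ∩ segCyl (φ x) (ψ y) ε) (φ x) (ψ y)

/-- Condition (7) of Theorem 7: `K` and `L` are congruent balls. -/
def T7Cond7 (d : ℕ) (K L : Set X) : Prop :=
  ∃ r > (0 : ℝ), (IsSphereSpace X d → r < Real.pi / 2) ∧
    (∃ p : X, K = closedBall p r) ∧ ∃ q : X, L = closedBall q r

/-- Condition (1) of Theorem 8. -/
def T8Cond1 (K L : Set X) : Prop :=
  ∀ φ ψ : X ≃ᵢ X, GoodPair 2 K L φ ψ → AxiallySymmetric (hullUnion K L φ ψ)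

/-- Condition (2) of Theorem 8. -/
def T8Cond2 (K L : Set X) : Prop :=
  ∀ φ ψ : X ≃ᵢ X, GoodPair 2 K L φ ψ → AdmitsNontrivialCongruence (hullUnion K L φ ψ)

/-- Condition (3) of Theorem 8. -/
def T8Cond3 (K L : Set X) : Prop :=
  ∃ δ > (0 : ℝ), ∀ φ ψ : X ≃ᵢ X, GoodPair 2 K L φ ψ →
    ∀ x ∈ frontier K, ∀ y ∈ frontier L,
      BigDiam 2 X (hullUnion K L φ ψ) δ →
      UniqueDiametral (hullUnion K L φ ψ) (φ x) (ψ y) →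
      AxiallySymmetric (hullUnion K L φ ψ)

/-- Condition (4) of Theorem 8. -/
def T8Cond4 (K L : Set X) : Prop :=
  ∃ δ > (0 : ℝ), ∀ φ ψ : X ≃ᵢ X, GoodPair 2 K L φ ψ →
    ∀ x ∈ frontier K, ∀ y ∈ frontier L,
      BigDiam 2 X (hullUnion K L φ ψ) δ →
      UniqueDiametral (hullUnion K L φ ψ) (φ x) (ψ y) →
      AdmitsNontrivialCongruence (hullUnion K L φ ψ)

/-- Condition (5) of Theorem 8. -/
def T8Cond5 (K L : Set X) : Prop :=
  ∃ δ > (0 : ℝ), ∀ φ ψ : X ≃ᵢ X, GoodPair 2 K L φ ψ →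
    ∀ x ∈ frontier K, ∀ y ∈ frontier L,
      BigDiam 2 X (hullUnion K L φ ψ) δ →
      UniqueDiametral (hullUnion K L φ ψ) (φ x) (ψ y) →
      ∃ ε₀ > (0 : ℝ), ∀ ε : ℝ, 0 < ε → ε < ε₀ →
        (IsSphereSpace X 2 → ∃ s : X, (⇑φ '' K) ∪ (⇑ψ '' L) ⊆ ball s (Real.pi / 2) ∧
            segCyl (φ x) (ψ y) ε ⊆ ball s (Real.pi / 2)) ∧
        AxiallySymmetric (hullUnion K L φ ψ ∩ segCyl (φ x) (ψ y) ε)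

/-- Condition (6) of Theorem 8. -/
def T8Cond6 (K L : Set X) : Prop :=
  ∃ δ > (0 : ℝ), ∀ φ ψ : X ≃ᵢ X, GoodPair 2 K L φ ψ →
    ∀ x ∈ frontier K, ∀ y ∈ frontier L,
      BigDiam 2 X (hullUnion K L φ ψ) δ →
      UniqueDiametral (hullUnion K L φ ψ) (φ x) (ψ y) →
      ∃ ε₀ > (0 : ℝ), ∀ ε : ℝ, 0 < ε → ε < ε₀ →
        (IsSphereSpace X 2 → ∃ s : X, (⇑φ '' K) ∪ (⇑ψ '' L) ⊆ ball s (Real.pi / 2) ∧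
            segCyl (φ x) (ψ y) ε ⊆ ball s (Real.pi / 2)) ∧
        AdmitsNontrivialCongruence (hullUnion K L φ ψ ∩ segCyl (φ x) (ψ y) ε)

/-- Condition (7) of Theorem 8: `K` and `L` are (in general incongruent) circles. -/
def T8Cond7 (K L : Set X) : Prop :=
  ∃ (p q : X) (r s : ℝ), 0 < r ∧ 0 < s ∧
    (IsSphereSpace X 2 → r < Real.pi / 2 ∧ s < Real.pi / 2) ∧
    K = closedBall p r ∧ L = closedBall q s

/-- A global chart of the hyperbolic plane by null coordinates: it identifies `X` with the sheet
`p * r - q ^ 2 = 1`, `0 < p` of a hyperboloid. In the upper half-plane model with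
`z = x + i * y` one has `p = 1 / y`, `q = x / y` and `r = (x ^ 2 + y ^ 2) / y`. -/
structure Chart (X : Type*) [MetricSpace X] where
  /-- The first null coordinate. -/
  p : X → ℝ
  /-- The spacelike coordinate. -/
  q : X → ℝ
  /-- The second null coordinate. -/
  r : X → ℝ
  p_pos : ∀ x, 0 < p x
  mul_eq : ∀ x, p x * r x = q x ^ 2 + 1
  surj : ∀ P Q : ℝ, 0 < P → ∃ x, p x = P ∧ q x = Q
  cosh_dist : ∀ x y, Real.cosh (dist x y) = (p x * r y + r x * p y) / 2 - q x * q y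

lemma dist_eq_of_cosh_eq {Y : Type*} [MetricSpace Y] {x y : X} {z w : Y}
    (h : Real.cosh (dist x y) = Real.cosh (dist z w)) : dist x y = dist z w :=
  Real.cosh_injOn (mem_Ici.2 dist_nonneg) (mem_Ici.2 dist_nonneg) h

lemma dist_lt_of_cosh_lt {x y : X} {d : ℝ} (hd : 0 ≤ d)
    (h : Real.cosh (dist x y) < Real.cosh d) : dist x y < d := by
  rwa [Real.cosh_lt_cosh, abs_of_nonneg dist_nonneg, abs_of_nonneg hd] at h

namespace Chart

variable (c : Chart X)

lemma r_pos (x : X) : 0 < c.r x := by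
  have h := c.mul_eq x
  have := c.p_pos x
  by_contra! h'
  nlinarith [sq_nonneg (c.q x), mul_nonneg this.le (neg_nonneg.2 h')]

lemma r_eq (x : X) : c.r x = (c.q x ^ 2 + 1) / c.p x := by
  rw [eq_div_iff (c.p_pos x).ne', ← c.mul_eq x]; ring

lemma r_eq_of {x y : X} (hp : c.p x = c.p y) (hq : c.q x = c.q y) : c.r x = c.r y := by
  rw [c.r_eq, c.r_eq, hp, hq]

lemma ext_point {x y : X} (hp : c.p x = c.p y) (hq : c.q x = c.q y) : x = y := by
  have h : Real.cosh (dist x y) = Real.cosh (dist x x) := by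
    rw [c.cosh_dist, c.cosh_dist, hp, hq, c.r_eq_of hp hq]
  have := dist_eq_of_cosh_eq h
  rwa [dist_self, dist_eq_zero] at this

/-- The point with given coordinates `p` and `q`. -/
noncomputable def pt (P Q : ℝ) (hP : 0 < P) : X := (c.surj P Q hP).choose

@[simp] lemma p_pt (P Q : ℝ) (hP : 0 < P) : c.p (c.pt P Q hP) = P :=
  (c.surj P Q hP).choose_spec.1

@[simp] lemma q_pt (P Q : ℝ) (hP : 0 < P) : c.q (c.pt P Q hP) = Q :=
  (c.surj P Q hP).choose_spec.2

@[simp] lemma r_pt (P Q : ℝ) (hP : 0 < P) : c.r (c.pt P Q hP) = (Q ^ 2 + 1) / P := by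
  rw [c.r_eq]; simp

lemma continuous_cosh_dist (y : X) : Continuous fun x => Real.cosh (dist x y) := by fun_prop

lemma continuous_add : Continuous fun x => c.p x + c.r x := by
  have h := continuous_cosh_dist (c.pt 1 0 one_pos)
  have e : (fun x => c.p x + c.r x) = fun x => 2 * Real.cosh (dist x (c.pt 1 0 one_pos)) := by
    ext x; rw [c.cosh_dist]; simp; ring
  rw [e]; exact continuous_const.mul h

lemma continuous_p : Continuous c.p := by
  have h := continuous_cosh_dist (c.pt 2 0 two_pos)
  have e : c.p = fun x => (4 / 3) * ((c.p x + c.r x)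
      - Real.cosh (dist x (c.pt 2 0 two_pos))) := by
    ext x; rw [c.cosh_dist]; simp; ring
  rw [e]; exact continuous_const.mul (c.continuous_add.sub h)

lemma continuous_r : Continuous c.r := by
  have e : c.r = fun x => (c.p x + c.r x) - c.p x := by ext x; ring
  rw [e]; exact c.continuous_add.sub c.continuous_p

lemma continuous_q : Continuous c.q := by
  have h := continuous_cosh_dist (c.pt 1 1 one_pos)
  have e : c.q = fun x => (2 * c.p x + c.r x) / 2
      - Real.cosh (dist x (c.pt 1 1 one_pos)) := by
    ext x; rw [c.cosh_dist]; simp; ring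
  rw [e]
  exact (((continuous_const.mul c.continuous_p).add c.continuous_r).div_const 2).sub h

/-- A point depends continuously on its coordinates. -/
lemma continuousAt_of_coord {Y : Type*} [TopologicalSpace Y] {g : Y → X} {y : Y}
    (hp : ContinuousAt (fun y => c.p (g y)) y) (hq : ContinuousAt (fun y => c.q (g y)) y) :
    ContinuousAt g y := by
  have hr : ContinuousAt (fun y => c.r (g y)) y := by
    simp only [c.r_eq]
    exact ((hq.pow 2).add continuousAt_const).div hp (c.p_pos _).ne'
  have hc : ContinuousAt (fun z => Real.cosh (dist (g z) (g y))) y := by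
    simp only [c.cosh_dist]
    fun_prop
  rw [ContinuousAt, Metric.tendsto_nhds]
  intro ε hε
  have : Real.cosh (dist (g y) (g y)) < Real.cosh ε := by
    rw [dist_self, Real.cosh_zero]; exact Real.one_lt_cosh.2 hε.ne'
  filter_upwards [hc.eventually_lt continuousAt_const this] with z hz
  exact dist_lt_of_cosh_lt hε.le hz

/-- The homeomorphism of `X` with `ℝ × ℝ` given by `x ↦ (log (p x), q x)`. -/
noncomputable def homeo : X ≃ₜ ℝ × ℝ where
  toFun x := (Real.log (c.p x), c.q x)
  invFun a := c.pt (Real.exp a.1) a.2 (Real.exp_pos _)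
  left_inv x := c.ext_point (by simp [Real.exp_log (c.p_pos x)]) (by simp)
  right_inv a := by simp
  continuous_toFun := (c.continuous_p.log fun x => (c.p_pos x).ne').prodMk c.continuous_q
  continuous_invFun := by
    rw [continuous_iff_continuousAt]
    intro a
    apply c.continuousAt_of_coord <;> simp <;> fun_prop

/-- Rescaling of the null coordinates. -/
noncomputable def scale (k : ℝ) (hk : 0 < k) : Chart X where
  p x := k * c.p x
  q := c.q
  r x := c.r x / k
  p_pos x := mul_pos hk (c.p_pos x)
  mul_eq x := by rw [← c.mul_eq]; field_simp
  surj P Q hP := ⟨c.pt (P / k) Q (div_pos hP hk), by simp; field_simp, by simp⟩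
  cosh_dist x y := by rw [c.cosh_dist]; field_simp

/-- Parabolic change of coordinates fixing `p`. -/
def shift (b : ℝ) : Chart X where
  p := c.p
  q x := c.q x + b * c.p x
  r x := c.r x + 2 * b * c.q x + b ^ 2 * c.p x
  p_pos := c.p_pos
  mul_eq x := by linear_combination c.mul_eq x
  surj P Q hP := ⟨c.pt P (Q - b * P) hP, by simp, by simp⟩
  cosh_dist x y := by rw [c.cosh_dist]; ring

/-- Exchange of the two null coordinates. -/
noncomputable def swap : Chart X where
  p := c.r
  q := c.q
  r := c.p
  p_pos := c.r_pos
  mul_eq x := by linear_combination c.mul_eq x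
  surj P Q hP := ⟨c.pt ((Q ^ 2 + 1) / P) Q (by positivity), by simp; field_simp, by simp⟩
  cosh_dist x y := by rw [c.cosh_dist]; ring

/-- Reversal of the spacelike coordinate. -/
def flip : Chart X where
  p := c.p
  q x := -c.q x
  r := c.r
  p_pos := c.p_pos
  mul_eq x := by linear_combination c.mul_eq x
  surj P Q hP := by
    obtain ⟨x, h1, h2⟩ := c.surj P (-Q) hP
    exact ⟨x, h1, by linarith⟩
  cosh_dist x y := by rw [c.cosh_dist]; ring

/-- Rotation of the coordinates `q` and `(r - p) / 2`. -/
noncomputable def rot (a b : ℝ) (hab : a ^ 2 + b ^ 2 = 1) : Chart X where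
  p x := (c.p x + c.r x) / 2 - (a * ((c.r x - c.p x) / 2) - b * c.q x)
  q x := a * c.q x + b * ((c.r x - c.p x) / 2)
  r x := (c.p x + c.r x) / 2 + (a * ((c.r x - c.p x) / 2) - b * c.q x)
  p_pos x := by
    have h1 := c.mul_eq x
    have h2 := c.p_pos x
    have h3 := c.r_pos x
    have := abs_lt_of_sq_lt_sq' (a := a * ((c.r x - c.p x) / 2) - b * c.q x)
      (b := (c.p x + c.r x) / 2) (by
        have : ((c.p x + c.r x) / 2) ^ 2 = (a * ((c.r x - c.p x) / 2) - b * c.q x) ^ 2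
            + (a * c.q x + b * ((c.r x - c.p x) / 2)) ^ 2 + 1 := by
          linear_combination h1 - (((c.r x - c.p x) / 2) ^ 2 + c.q x ^ 2) * hab
        nlinarith [sq_nonneg (a * c.q x + b * ((c.r x - c.p x) / 2))]) (by linarith)
    linarith [this.2]
  mul_eq x := by
    linear_combination c.mul_eq x - (((c.r x - c.p x) / 2) ^ 2 + c.q x ^ 2) * hab
  surj P Q hP := by
    set R := (Q ^ 2 + 1) / P with hR
    have hPR : P * R = Q ^ 2 + 1 := by rw [hR]; field_simp
    have hR0 : 0 < R := by positivity
    have hlt := abs_lt_of_sq_lt_sq' (a := a * ((R - P) / 2) + b * Q)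
      (b := (P + R) / 2) (by
        have : ((P + R) / 2) ^ 2 = (a * ((R - P) / 2) + b * Q) ^ 2
            + (a * Q - b * ((R - P) / 2)) ^ 2 + 1 := by
          linear_combination hPR - (((R - P) / 2) ^ 2 + Q ^ 2) * hab
        nlinarith [sq_nonneg (a * Q - b * ((R - P) / 2))]) (by linarith)
    have hP' : 0 < (P + R) / 2 - (a * ((R - P) / 2) + b * Q) := by linarith [hlt.2]
    obtain ⟨x, h1, h2⟩ := c.surj _ (a * Q - b * ((R - P) / 2)) hP'
    have h3 : c.r x = (P + R) / 2 + (a * ((R - P) / 2) + b * Q) := by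
      have h4 := c.mul_eq x
      rw [h1, h2] at h4
      apply mul_left_cancel₀ hP'.ne'
      linear_combination h4 - hPR + (((R - P) / 2) ^ 2 + Q ^ 2) * hab
    refine ⟨x, ?_, ?_⟩
    · simp only [h1, h2, h3]
      linear_combination - ((R - P) / 2) * hab
    · simp only [h1, h2, h3]
      linear_combination Q * hab
  cosh_dist x y := by
    rw [c.cosh_dist]
    linear_combination (-(((c.r x - c.p x) / 2) * ((c.r y - c.p y) / 2) + c.q x * c.q y)) * (- hab)

/-- The pull-back of a chart by an isometry. -/
def comp (f : X ≃ᵢ X) : Chart X where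
  p x := c.p (f x)
  q x := c.q (f x)
  r x := c.r (f x)
  p_pos x := c.p_pos _
  mul_eq x := c.mul_eq _
  surj P Q hP := ⟨f.symm (c.pt P Q hP), by simp, by simp⟩
  cosh_dist x y := by rw [← c.cosh_dist, f.dist_eq]

/-- The isometry which turns the coordinates of one chart into those of another one. -/
noncomputable def transition (c' : Chart X) : X ≃ᵢ X where
  toFun x := c'.pt (c.p x) (c.q x) (c.p_pos x)
  invFun x := c.pt (c'.p x) (c'.q x) (c'.p_pos x)
  left_inv x := c.ext_point (by simp) (by simp)
  right_inv x := c'.ext_point (by simp) (by simp)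
  isometry_toFun := Isometry.of_dist_eq fun x y => dist_eq_of_cosh_eq (by
    rw [c'.cosh_dist, c.cosh_dist]; simp [c.r_eq])

@[simp] lemma p_transition (c' : Chart X) (x : X) : c'.p (c.transition c' x) = c.p x :=
  c'.p_pt _ _ (c.p_pos x)

@[simp] lemma q_transition (c' : Chart X) (x : X) : c'.q (c.transition c' x) = c.q x :=
  c'.q_pt _ _ (c.p_pos x)

/-- The reflection `q ↦ -q` in the line `q = 0`. -/
noncomputable def mirror : X ≃ᵢ X := c.flip.transition c

@[simp] lemma p_mirror (x : X) : c.p (c.mirror x) = c.p x := c.flip.p_transition c x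

@[simp] lemma q_mirror (x : X) : c.q (c.mirror x) = -c.q x := c.flip.q_transition c x

@[simp] lemma r_mirror (x : X) : c.r (c.mirror x) = c.r x := by simp [c.r_eq]

lemma mirror_mirror (x : X) : c.mirror (c.mirror x) = x := c.ext_point (by simp) (by simp)

lemma mirror_eq_self_iff (x : X) : c.mirror x = x ↔ c.q x = 0 := by
  refine ⟨fun h => ?_, fun h => c.ext_point (by simp) (by simp [h])⟩
  have := congrArg c.q h
  rw [q_mirror] at this; linarith

lemma isReflection_mirror : IsReflection c.mirror := by
  refine ⟨?_, ?_, ?_⟩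
  · ext x; exact c.mirror_mirror x
  · intro h
    have : c.mirror (c.pt 1 1 one_pos) = c.pt 1 1 one_pos := by rw [h]; rfl
    rw [mirror_eq_self_iff] at this
    simp at this
  · intro h
    have e : {x : X | c.mirror x ≠ x} = {x | c.q x ≠ 0} := by
      ext x; simp [mirror_eq_self_iff]
    rw [e] at h
    have h2 := h.image c.q c.continuous_q.continuousOn
    have h3 := h2.ordConnected.out (x := -1) (y := 1)
      ⟨c.pt 1 (-1) one_pos, by simp, by simp⟩ ⟨c.pt 1 1 one_pos, by simp, by simp⟩
    obtain ⟨x, hx, hx0⟩ := h3 (show (0 : ℝ) ∈ Icc (-1) 1 by simp)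
    exact hx hx0

end Chart

lemma exists_chart (hX : IsHyperbolicSpace X 2) : Nonempty (Chart X) := by
  obtain ⟨e, -, hrange, hdist⟩ := hX
  have hin : ∀ u v : EuclideanSpace ℝ (Fin 2) × ℝ,
      mink 2 u v = u.1 0 * v.1 0 + u.1 1 * v.1 1 - u.2 * v.2 := by
    intro u v
    simp [mink, PiLp.inner_apply, Fin.sum_univ_two]
    ring
  have hmem : ∀ x, mink 2 (e x) (e x) = -1 ∧ 0 < (e x).2 := by
    intro x
    have : e x ∈ range e := mem_range_self x
    rwa [hrange] at this
  refine ⟨⟨fun x => (e x).2 - (e x).1 1, fun x => (e x).1 0, fun x => (e x).2 + (e x).1 1,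
    fun x => ?_, fun x => ?_, fun P Q hP => ?_, fun x y => ?_⟩⟩
  · obtain ⟨h1, h2⟩ := hmem x
    rw [hin] at h1
    have := abs_lt_of_sq_lt_sq' (a := (e x).1 1) (b := (e x).2)
      (by nlinarith [sq_nonneg ((e x).1 0)]) h2.le
    linarith [this.2]
  · obtain ⟨h1, h2⟩ := hmem x
    rw [hin] at h1
    linear_combination -h1
  · set R := (Q ^ 2 + 1) / P with hR
    have hPR : P * R = Q ^ 2 + 1 := by rw [hR]; field_simp
    have hR0 : 0 < R := by positivity
    have : ((!₂[Q, (R - P) / 2], (R + P) / 2) : EuclideanSpace ℝ (Fin 2) × ℝ) ∈ range e := by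
      rw [hrange]
      refine ⟨?_, ?_⟩
      · rw [hin]; simp; linear_combination -hPR
      · simp only; positivity
    obtain ⟨x, hx⟩ := this
    refine ⟨x, ?_, ?_⟩
    · simp [hx]; ring
    · simp [hx]
  · rw [hdist, hin]; ring

namespace Chart

variable (c : Chart X)

/-- A chart in which `x` is the base point and `y` lies on the axis. -/
lemma exists_axis (c : Chart X) (x y : X) :
    ∃ d : Chart X, d.p x = 1 ∧ d.q x = 0 ∧ d.q y = 0 ∧ d.p y ≤ 1 := by
  set c₁ := (c.shift (-c.q x / c.p x)).scale (1 / c.p x) (one_div_pos.2 (c.p_pos x)) with hc₁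
  have hp1 : c₁.p x = 1 := by
    have := (c.p_pos x).ne'
    simp [hc₁, scale, shift]; field_simp
  have hq1 : c₁.q x = 0 := by
    have := (c.p_pos x).ne'
    simp [hc₁, scale, shift]; field_simp; ring
  clear_value c₁
  have hr1 : c₁.r x = 1 := by rw [c₁.r_eq, hp1, hq1]; norm_num
  set D := (c₁.r y - c₁.p y) / 2 with hD
  by_cases hz : D ^ 2 + c₁.q y ^ 2 = 0
  · refine ⟨c₁, hp1, hq1, ?_, ?_⟩
    · nlinarith [sq_nonneg D, sq_nonneg (c₁.q y)]
    · have h1 : D = 0 := by nlinarith [sq_nonneg D, sq_nonneg (c₁.q y)]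
      have h2 : c₁.q y = 0 := by nlinarith [sq_nonneg D, sq_nonneg (c₁.q y)]
      have h3 := c₁.mul_eq y
      have h4 : c₁.r y = c₁.p y := by linarith
      rw [h2, h4] at h3
      nlinarith [c₁.p_pos y]
  · have hpos : 0 < D ^ 2 + c₁.q y ^ 2 := lt_of_le_of_ne (by positivity) (Ne.symm hz)
    set ρ := Real.sqrt (D ^ 2 + c₁.q y ^ 2) with hρ
    have hρ0 : 0 < ρ := Real.sqrt_pos.2 hpos
    have hρ2 : ρ ^ 2 = D ^ 2 + c₁.q y ^ 2 := Real.sq_sqrt hpos.le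
    have hab : (D / ρ) ^ 2 + (-c₁.q y / ρ) ^ 2 = 1 := by
      field_simp; rw [hρ2]
    have hq : D / ρ * c₁.q y + -c₁.q y / ρ * D = 0 := by ring
    refine ⟨c₁.rot _ _ hab, ?_, ?_, ?_, ?_⟩
    · simp [rot, hp1, hr1, hq1]
    · simp [rot, hp1, hr1, hq1]
    · exact hq
    · have h1 : (c₁.rot _ _ hab).q y = 0 := hq
      have h2 := (c₁.rot _ _ hab).mul_eq y
      have h3 : (c₁.rot _ _ hab).p y ≤ (c₁.rot _ _ hab).r y := by
        have : D / ρ * D - -c₁.q y / ρ * c₁.q y = ρ := by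
          field_simp; rw [hρ2]; ring
        simp only [rot]
        rw [← hD, this]
        linarith
      rw [h1] at h2
      nlinarith [(c₁.rot _ _ hab).p_pos y]

/-- A chart in which `x` and `y` are symmetric points of the axis. -/
lemma exists_symmetric_axis (c : Chart X) (x y : X) :
    ∃ d : Chart X, d.q x = 0 ∧ d.q y = 0 ∧ d.p x = d.r y ∧ d.r x = d.p y := by
  obtain ⟨c₁, h1, h2, h3, -⟩ := c.exists_axis x y
  set P := c₁.p y with hP
  have hP0 : 0 < P := c₁.p_pos y
  have hs := Real.sqrt_pos.2 hP0
  have hs2 : Real.sqrt P * Real.sqrt P = P := Real.mul_self_sqrt hP0.le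
  set s := Real.sqrt P with hs'
  refine ⟨c₁.scale (1 / s) (by positivity), h2, h3, ?_, ?_⟩
  · simp [scale, h1, h3, c₁.r_eq, ← hP]
    rw [← hs2]; field_simp
  · simp [scale, h1, h2, c₁.r_eq, ← hP]
    rw [← hs2]; field_simp

/-- The chart whose line `q = 0` is perpendicular to that of `c` in the base point. -/
noncomputable def perp : Chart X := c.rot 0 1 (by norm_num)

lemma p_perp (x : X) : c.perp.p x = (c.p x + c.r x) / 2 + c.q x := by simp [perp, rot]

lemma q_perp (x : X) : c.perp.q x = (c.r x - c.p x) / 2 := by simp [perp, rot]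

lemma r_perp (x : X) : c.perp.r x = (c.p x + c.r x) / 2 - c.q x := by simp [perp, rot]; ring

lemma p_mirror_perp (x : X) : c.p (c.perp.mirror x) = c.r x := by
  have h1 := c.perp.p_mirror x
  have h2 := c.perp.q_mirror x
  have h3 := c.perp.r_mirror x
  simp only [p_perp, q_perp, r_perp] at h1 h2 h3
  linarith

lemma r_mirror_perp (x : X) : c.r (c.perp.mirror x) = c.p x := by
  have h1 := c.perp.p_mirror x
  have h2 := c.perp.q_mirror x
  have h3 := c.perp.r_mirror x
  simp only [p_perp, q_perp, r_perp] at h1 h2 h3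
  linarith

lemma q_mirror_perp (x : X) : c.q (c.perp.mirror x) = c.q x := by
  have h1 := c.perp.p_mirror x
  have h3 := c.perp.r_mirror x
  simp only [p_perp, r_perp] at h1 h3
  linarith

/-- A chart in which the line `q = 0` is the perpendicular bisector of `x` and `y`. -/
lemma exists_bisector (c : Chart X) (x y : X) :
    ∃ d : Chart X, d.p x = d.p y ∧ d.q x = -d.q y := by
  obtain ⟨a, h1, h2, h3, h4⟩ := c.exists_symmetric_axis x y
  exact ⟨a.perp, by rw [p_perp, p_perp, h1, h2, h3, h4]; ring, by
    rw [q_perp, q_perp, h3, h4]; ring⟩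

lemma dist_eq_iff_of_bisector {x y z : X} (hp : c.p x = c.p y) (hq : c.q x = -c.q y)
    (hxy : x ≠ y) : dist z x = dist z y ↔ c.q z = 0 := by
  have hr : c.r x = c.r y := by rw [c.r_eq, c.r_eq, hp, hq]; simp
  have hy : c.q y ≠ 0 := fun h => hxy (c.ext_point hp (by rw [hq, h]; simp))
  constructor
  · intro h
    have h' := congrArg Real.cosh h
    rw [c.cosh_dist, c.cosh_dist, hp, hq, hr] at h'
    have : c.q z * c.q y = 0 := by linarith
    simpa [hy] using this
  · intro h
    apply dist_eq_of_cosh_eq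
    rw [c.cosh_dist, c.cosh_dist, hp, hq, hr, h]; ring

/-- An isometry preserving both null coordinates is trivial or a reflection. -/
lemma eq_refl_or_mirror {f : X ≃ᵢ X} (hp : ∀ x, c.p (f x) = c.p x)
    (hr : ∀ x, c.r (f x) = c.r x) : f = IsometryEquiv.refl X ∨ f = c.mirror := by
  have hq2 : ∀ x, c.q (f x) = c.q x ∨ c.q (f x) = - c.q x := fun x => by
    have h1 := c.mul_eq x
    have h2 := c.mul_eq (f x)
    rw [hp, hr] at h2
    exact sq_eq_sq_iff_eq_or_eq_neg.1 (by linarith)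
  by_cases h : ∀ x, c.q (f x) = c.q x
  · left; ext x; exact c.ext_point (hp x) (h x)
  · right
    push Not at h
    obtain ⟨w, hw⟩ := h
    have hw' := (hq2 w).resolve_left hw
    have hw0 : c.q w ≠ 0 := fun h0 => hw (by rw [hw', h0]; simp)
    ext x
    refine c.ext_point (by simp [hp]) ?_
    rw [q_mirror]
    rcases hq2 x with hx | hx
    · have h1 := congrArg Real.cosh (f.dist_eq x w)
      rw [c.cosh_dist, c.cosh_dist, hp, hp, hr, hr, hx, hw'] at h1
      have : c.q x * c.q w = 0 := by linarith
      have : c.q x = 0 := by simpa [hw0] using this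
      rw [hx, this]; simp
    · exact hx

end Chart

/-- An isometry fixing two points is trivial or a reflection. -/
lemma eq_refl_or_mirror_of_fixed (c₀ : Chart X) {f : X ≃ᵢ X} {x y : X} (hxy : x ≠ y)
    (hx : f x = x) (hy : f y = y) :
    f = IsometryEquiv.refl X ∨ ∃ c : Chart X, f = c.mirror ∧ c.q x = 0 ∧ c.q y = 0 := by
  obtain ⟨c, h1, h2, h3, -⟩ := c₀.exists_axis x y
  have hP := c.p_pos y
  have hP1 : c.p y ≠ 1 := fun h => hxy (c.ext_point (by rw [h1, h]) (by rw [h2, h3]))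
  have key : ∀ z, c.p (f z) + c.r (f z) = c.p z + c.r z ∧
      c.p (f z) + c.p y ^ 2 * c.r (f z) = c.p z + c.p y ^ 2 * c.r z := by
    intro z
    have e1 := congrArg Real.cosh (f.dist_eq z x)
    have e2 := congrArg Real.cosh (f.dist_eq z y)
    rw [hx, c.cosh_dist, c.cosh_dist, c.r_eq x, h1, h2] at e1
    rw [hy, c.cosh_dist, c.cosh_dist, c.r_eq y, h3] at e2
    constructor
    · linarith
    · field_simp at e2; linarith
  have hne : c.p y ^ 2 - 1 ≠ 0 := by
    intro h
    have : (c.p y - 1) * (c.p y + 1) = 0 := by linear_combination h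
    rcases mul_eq_zero.1 this with h | h
    · exact hP1 (by linarith)
    · linarith
  have hr : ∀ z, c.r (f z) = c.r z := fun z => by
    apply mul_left_cancel₀ hne
    linear_combination (key z).2 - (key z).1
  have hp : ∀ z, c.p (f z) = c.p z := fun z => by linarith [(key z).1, hr z]
  rcases c.eq_refl_or_mirror hp hr with h | h
  · exact Or.inl h
  · exact Or.inr ⟨c, h, h2, h3⟩

lemma IsReflection.exists_chart (c : Chart X) {σ : X ≃ᵢ X} (hσ : IsReflection σ) :
    ∃ d : Chart X, σ = d.mirror := by
  obtain ⟨hinv, hne, hconn⟩ := hσ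
  have hinv' : ∀ x, σ (σ x) = x := fun x => congrArg (fun f : X ≃ᵢ X => f x) hinv
  obtain ⟨x, hx⟩ : ∃ x, σ x ≠ x := by
    by_contra! h
    exact hne (IsometryEquiv.ext h)
  obtain ⟨a, h1, h2, h3, h4⟩ := c.exists_symmetric_axis x (σ x)
  have hpx := a.p_pos x
  have hrx := a.r_pos x
  have hne' : a.p x ^ 2 - a.r x ^ 2 ≠ 0 := by
    intro h
    have h5 : (a.p x - a.r x) * (a.p x + a.r x) = 0 := by linear_combination h
    have h6 : a.p x = a.r x := by
      rcases mul_eq_zero.1 h5 with h | h <;> linarith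
    exact hx (a.ext_point (by rw [← h4, h6]) (by rw [h1, h2]))
  have key : ∀ z, a.p (σ z) = a.r z ∧ a.r (σ z) = a.p z := by
    intro z
    have e1 := congrArg Real.cosh (σ.dist_eq z x)
    have e2 := congrArg Real.cosh (σ.dist_eq z (σ x))
    rw [a.cosh_dist, a.cosh_dist, h1, h2, ← h3, ← h4] at e1
    rw [hinv', a.cosh_dist, a.cosh_dist, h1, h2, ← h3, ← h4] at e2
    constructor <;> apply mul_left_cancel₀ hne'
    · linear_combination 2 * a.p x * e1 - 2 * a.r x * e2
    · linear_combination -2 * a.r x * e1 + 2 * a.p x * e2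
  have hp : ∀ z, a.p ((σ.trans a.perp.mirror) z) = a.p z := fun z => by
    change a.p (a.perp.mirror (σ z)) = _
    rw [a.p_mirror_perp, (key z).2]
  have hr : ∀ z, a.r ((σ.trans a.perp.mirror) z) = a.r z := fun z => by
    change a.r (a.perp.mirror (σ z)) = _
    rw [a.r_mirror_perp, (key z).1]
  rcases a.eq_refl_or_mirror hp hr with h | h
  · refine ⟨a.perp, IsometryEquiv.ext fun z => ?_⟩
    have : a.perp.mirror (σ z) = z := congrArg (fun f : X ≃ᵢ X => f z) h
    rw [← Chart.mirror_mirror a.perp (σ z), this]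
  · exfalso
    apply hconn
    have hq : ∀ z, a.q (σ z) = -a.q z := fun z => by
      have : a.perp.mirror (σ z) = a.mirror z := congrArg (fun f : X ≃ᵢ X => f z) h
      rw [← a.q_mirror_perp, this, a.q_mirror]
    have hfix : {z : X | σ z ≠ z} = {a.pt 1 0 one_pos}ᶜ := by
      ext z
      simp only [mem_ofPred_eq, mem_compl_iff, mem_singleton_iff, not_iff_not]
      constructor
      · intro hz
        have hqz : a.q z = 0 := by have := hq z; rw [hz] at this; linarith
        have hpz : a.p z = a.r z := by have := (key z).1; rwa [hz] at this
        have := a.mul_eq z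
        rw [← hpz, hqz] at this
        exact a.ext_point (by rw [a.p_pt]; nlinarith [a.p_pos z]) (by rw [a.q_pt, hqz])
      · rintro rfl
        exact a.ext_point (by rw [(key _).1]; simp) (by rw [hq]; simp)
    rw [hfix]
    have h5 := (isConnected_compl_singleton_of_one_lt_rank (E := ℝ × ℝ) (by simp [one_add_one_eq_two])
      (a.homeo (a.pt 1 0 one_pos))).isPreconnected
    have h6 := h5.image a.homeo.symm a.homeo.symm.continuous.continuousOn
    rwa [image_compl_eq a.homeo.symm.bijective, image_singleton,
      a.homeo.symm_apply_apply] at h6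

/-- A product of reflections. -/
def IsReflectionProduct (f : X ≃ᵢ X) : Prop :=
  ∃ l : List (X ≃ᵢ X), (∀ σ ∈ l, IsReflection σ) ∧
    f = l.foldr IsometryEquiv.trans (IsometryEquiv.refl X)

lemma foldr_trans_append (l l' : List (X ≃ᵢ X)) :
    (l ++ l').foldr IsometryEquiv.trans (IsometryEquiv.refl X) =
      (l.foldr IsometryEquiv.trans (IsometryEquiv.refl X)).trans
        (l'.foldr IsometryEquiv.trans (IsometryEquiv.refl X)) := by
  induction l with
  | nil => rfl
  | cons a l ih => simp only [List.cons_append, List.foldr_cons, ih]; rfl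

lemma IsReflectionProduct.trans {f g : X ≃ᵢ X} (hf : IsReflectionProduct f)
    (hg : IsReflectionProduct g) : IsReflectionProduct (f.trans g) := by
  obtain ⟨l, hl, rfl⟩ := hf
  obtain ⟨l', hl', rfl⟩ := hg
  refine ⟨l ++ l', fun σ hσ => ?_, (foldr_trans_append l l').symm⟩
  rcases List.mem_append.1 hσ with h | h
  · exact hl σ h
  · exact hl' σ h

lemma isReflectionProduct_refl : IsReflectionProduct (IsometryEquiv.refl X) :=
  ⟨[], by simp, rfl⟩

lemma IsReflection.isReflectionProduct {σ : X ≃ᵢ X} (h : IsReflection σ) :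
    IsReflectionProduct σ :=
  ⟨[σ], by simpa using h, rfl⟩

lemma exists_swap (c : Chart X) (x y : X) :
    ∃ g : X ≃ᵢ X, IsReflectionProduct g ∧ (∀ z, g (g z) = z) ∧ g y = x ∧
      ∀ z, dist z x = dist z y → g z = z := by
  by_cases hxy : x = y
  · exact ⟨IsometryEquiv.refl X, isReflectionProduct_refl, fun _ => rfl, hxy.symm, fun _ _ => rfl⟩
  · obtain ⟨d, hp, hq⟩ := c.exists_bisector x y
    refine ⟨d.mirror, d.isReflection_mirror.isReflectionProduct, d.mirror_mirror, ?_, ?_⟩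
    · exact d.ext_point (by simp [hp]) (by simp [hq])
    · intro z hz
      rwa [d.mirror_eq_self_iff, ← d.dist_eq_iff_of_bisector hp hq hxy]

/-- Every isometry of the hyperbolic plane is a product of reflections. -/
lemma isReflectionProduct (c : Chart X) (f : X ≃ᵢ X) : IsReflectionProduct f := by
  set x := c.pt 1 0 one_pos
  set y := c.pt 1 1 one_pos with hy
  have hxy : x ≠ y := fun h => by
    have := congrArg c.q h
    simp [x, y] at this
  obtain ⟨g₁, hg₁, hi₁, h₁, -⟩ := exists_swap c x (f x)
  obtain ⟨g₂, hg₂, hi₂, h₂, h₂'⟩ := exists_swap c y (g₁ (f y))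
  have hx : ((f.trans g₁).trans g₂) x = x := by
    change g₂ (g₁ (f x)) = x
    rw [h₁]
    apply h₂'
    conv_rhs => rw [← h₁]
    rw [g₁.dist_eq, f.dist_eq]
  have h := eq_refl_or_mirror_of_fixed c hxy hx h₂
  have hprod : IsReflectionProduct ((f.trans g₁).trans g₂) := by
    rcases h with h | ⟨d, h, -⟩
    · rw [h]; exact isReflectionProduct_refl
    · rw [h]; exact d.isReflection_mirror.isReflectionProduct
  have e : f = (((f.trans g₁).trans g₂).trans g₂).trans g₁ := by
    ext z
    change f z = g₁ (g₂ (g₂ (g₁ (f z))))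
    rw [hi₂, hi₁]
  rw [e]
  exact (hprod.trans hg₂).trans hg₁

lemma orientationPreserving_refl : OrientationPreserving (IsometryEquiv.refl X) :=
  ⟨[], by simp, by simp, rfl⟩

lemma orientationPreserving_or_trans {f σ : X ≃ᵢ X} (hf : IsReflectionProduct f)
    (hσ : IsReflection σ) : OrientationPreserving f ∨ OrientationPreserving (f.trans σ) := by
  obtain ⟨l, hl, rfl⟩ := hf
  rcases Nat.even_or_odd l.length with h | h
  · exact Or.inl ⟨l, hl, h, rfl⟩
  · refine Or.inr ⟨l ++ [σ], fun τ hτ => ?_, ?_, ?_⟩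
    · rcases List.mem_append.1 hτ with h | h
      · exact hl τ h
      · rw [List.mem_singleton.1 h]; exact hσ
    · rw [List.length_append]; exact h.add_one
    · rw [foldr_trans_append]; rfl

/-- Orientation-preserving congruences act transitively on the horoballs `p ≤ 1`. -/
lemma Chart.exists_orientationPreserving (c d : Chart X) :
    ∃ φ : X ≃ᵢ X, OrientationPreserving φ ∧ φ '' {x | c.p x ≤ 1} = {x | d.p x ≤ 1} := by
  have key : ∀ φ : X ≃ᵢ X, (∀ x, d.p (φ x) = c.p x) →
      φ '' {x | c.p x ≤ 1} = {x | d.p x ≤ 1} := by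
    intro φ h
    ext y
    constructor
    · rintro ⟨x, hx, rfl⟩
      simpa [h] using hx
    · intro hy
      refine ⟨φ.symm y, ?_, by simp⟩
      have := h (φ.symm y)
      rw [φ.apply_symm_apply] at this
      simpa [← this] using hy
  rcases orientationPreserving_or_trans (isReflectionProduct c (c.transition d))
    d.isReflection_mirror with h | h
  · exact ⟨_, h, key _ fun x => c.p_transition d x⟩
  · refine ⟨_, h, key _ fun x => ?_⟩
    change d.p (d.mirror (c.transition d x)) = _
    rw [d.p_mirror, c.p_transition]

lemma Chart.tendsto_busemann (c : Chart X) {γ : ℝ → X} (hp : ∀ t, c.p (γ t) = Real.exp (-t))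
    (hq : ∀ t, c.q (γ t) = 0) (x : X) :
    Tendsto (fun t => dist x (γ t) - t) atTop (nhds (Real.log (c.p x))) := by
  have hexp : Tendsto (fun t : ℝ => Real.exp (-t)) atTop (nhds 0) :=
    Real.tendsto_exp_neg_atTop_nhds_zero
  have h1 : ∀ t, Real.exp (dist x (γ t) - t) =
      c.p x + c.r x * (Real.exp (-t) * Real.exp (-t)) - Real.exp (-dist x (γ t)) * Real.exp (-t) := by
    intro t
    have h := c.cosh_dist x (γ t)
    rw [c.r_eq (γ t), hp, hq, Real.cosh_eq] at h
    have h2 : Real.exp (-t) ≠ 0 := (Real.exp_pos _).ne'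
    rw [sub_eq_add_neg, Real.exp_add]
    field_simp at h
    linear_combination h
  have h2 : Tendsto (fun t => Real.exp (-dist x (γ t)) * Real.exp (-t)) atTop (nhds 0) := by
    refine squeeze_zero (fun t => by positivity) (fun t => ?_) hexp
    have : Real.exp (-dist x (γ t)) ≤ 1 := Real.exp_le_one_iff.2 (by simp)
    have := Real.exp_pos (-t)
    nlinarith
  have h3 : Tendsto (fun t => Real.exp (dist x (γ t) - t)) atTop (nhds (c.p x)) := by
    have := ((hexp.mul hexp).const_mul (c.r x)).const_add (c.p x) |>.sub h2
    simp only [mul_zero, add_zero, sub_zero] at this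
    exact this.congr fun t => (h1 t).symm
  have h4 := h3.log (c.p_pos x).ne'
  simpa using h4

/-- Along a geodesic parametrized by arc length one may choose a standard chart. -/
lemma Chart.exists_of_geodesic (c : Chart X) {γ : ℝ → X} (hγ : Isometry γ) :
    ∃ d : Chart X, (∀ t, d.p (γ t) = Real.exp (-t)) ∧ ∀ t, d.q (γ t) = 0 := by
  obtain ⟨d, h1, h2, h3, h4⟩ := c.exists_axis (γ 0) (γ 1)
  have hp1 : d.p (γ 1) = Real.exp (-1) := by
    set s := - Real.log (d.p (γ 1)) with hs
    have hs' : d.p (γ 1) = Real.exp (-s) := by rw [hs, neg_neg, Real.exp_log (d.p_pos _)]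
    have hs0 : 0 ≤ s := by
      have := Real.log_nonpos (d.p_pos _).le h4
      linarith
    have h5 := d.cosh_dist (γ 0) (γ 1)
    rw [hγ.dist_eq, d.r_eq, d.r_eq, h1, h2, h3, hs'] at h5
    have h6 : Real.cosh 1 = Real.cosh s := by
      rw [Real.cosh_eq s]
      rw [dist_comm, Real.dist_eq, sub_zero, abs_one] at h5
      rw [h5]
      simp [Real.exp_neg]
    have := Real.cosh_injOn (mem_Ici.2 zero_le_one) (mem_Ici.2 hs0) h6
    rw [hs', this]
  have key : ∀ t, d.p (γ t) = Real.exp (-t) ∧ d.r (γ t) = Real.exp t := by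
    intro t
    have e0 := d.cosh_dist (γ t) (γ 0)
    have e1 := d.cosh_dist (γ t) (γ 1)
    rw [hγ.dist_eq, Real.dist_eq, Real.cosh_abs, d.r_eq (γ 0), h1, h2, sub_zero,
      Real.cosh_eq] at e0
    rw [hγ.dist_eq, Real.dist_eq, Real.cosh_abs, d.r_eq (γ 1), hp1, h3, Real.cosh_eq, neg_sub,
      Real.exp_sub, Real.exp_sub, Real.exp_neg] at e1
    rw [Real.exp_neg] at e0 ⊢
    have ht := Real.exp_pos t
    have he : 1 < Real.exp 1 := Real.one_lt_exp_iff.2 one_pos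
    have he2 : Real.exp 1 ^ 2 - 1 ≠ 0 := by nlinarith
    field_simp at e0 e1
    constructor
    · have h5 : d.p (γ t) * Real.exp t = 1 := by
        apply mul_left_cancel₀ he2
        linear_combination e0 - e1
      field_simp
      linarith
    · apply mul_left_cancel₀ he2
      apply mul_left_cancel₀ ht.ne'
      linear_combination - (Real.exp 1) ^ 2 * e0 + e1
  refine ⟨d, fun t => (key t).1, fun t => ?_⟩
  have := d.mul_eq (γ t)
  rw [(key t).1, (key t).2, ← Real.exp_add, neg_add_cancel, Real.exp_zero] at this
  nlinarith

lemma IsParaball.exists_chart (c : Chart X) {K : Set X} (hK : IsParaball K) :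
    ∃ d : Chart X, K = {x | d.p x ≤ 1} := by
  obtain ⟨γ, hγ, rfl⟩ := hK
  obtain ⟨d, hp, hq⟩ := c.exists_of_geodesic hγ
  refine ⟨d, ?_⟩
  ext x
  have h := d.tendsto_busemann hp hq x
  simp only [mem_ofPred_eq]
  rw [← Real.log_nonpos_iff (d.p_pos x).le]
  constructor
  · rintro ⟨b, hb, hb'⟩
    rwa [tendsto_nhds_unique h hb']
  · exact fun hb => ⟨_, hb, h⟩

namespace Chart

variable (c : Chart X)

lemma isPreconnected_q_preimage {T : Set ℝ} (hT : T.OrdConnected) :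
    IsPreconnected {x | c.q x ∈ T} := by
  have h : IsPreconnected (univ ×ˢ T : Set (ℝ × ℝ)) :=
    isPreconnected_univ.prod hT.isPreconnected
  have h2 := h.image c.homeo.symm c.homeo.symm.continuous.continuousOn
  convert h2 using 1
  rw [c.homeo.image_symm]
  ext x
  simp [homeo]

/-- The points `q = 0` realize the distance to a set lying beyond that line. -/
lemma infDist_le_iff {S : Set X} (hS : {z | c.q z = 0} ⊆ S) {x : X}
    (hx : ∀ z ∈ S, c.q x * c.q z ≤ 0) {l : ℝ} (hl : 0 ≤ l) :
    infDist x S ≤ l ↔ |c.q x| ≤ Real.sinh l := by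
  have hpos := c.p_pos x
  have hrpos := c.r_pos x
  have hpr := c.mul_eq x
  set w := Real.sqrt (c.q x ^ 2 + 1) with hw
  have hw2 : w * w = c.q x ^ 2 + 1 := Real.mul_self_sqrt (by positivity)
  have hw0 : 0 < w := Real.sqrt_pos.2 (by positivity)
  set m := c.pt (c.p x / w) 0 (by positivity) with hm
  have hmS : m ∈ S := hS (by simp [hm])
  have hdm : Real.cosh (dist x m) = w := by
    rw [c.cosh_dist]
    simp only [hm, p_pt, q_pt, r_pt]
    field_simp
    linear_combination hpr - hw2
  have hmin : ∀ z ∈ S, dist x m ≤ dist x z := by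
    intro z hz
    rw [← abs_of_nonneg (dist_nonneg (x := x) (y := m)),
      ← abs_of_nonneg (dist_nonneg (x := x) (y := z)), ← Real.cosh_le_cosh, hdm, c.cosh_dist]
    have h1 := hx z hz
    have h2 := c.mul_eq z
    have h3 := c.p_pos z
    have h4 := c.r_pos z
    have h5 : w ≤ (c.p x * c.r z + c.r x * c.p z) / 2 := by
      refine le_of_abs_le (abs_le_of_sq_le_sq ?_ (by positivity))
      have h6 : (c.p x * c.r z) * (c.r x * c.p z) = (c.q x ^ 2 + 1) * (c.q z ^ 2 + 1) := by
        rw [← hpr, ← h2]; ring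
      nlinarith [sq_nonneg (c.p x * c.r z - c.r x * c.p z), sq_nonneg (c.q z),
        mul_nonneg (sq_nonneg (c.q z)) (sq_nonneg (c.q x))]
    linarith
  have hinf : infDist x S = dist x m :=
    le_antisymm (infDist_le_dist_of_mem hmS) ((le_infDist ⟨m, hmS⟩).2 fun {z} hz => hmin z hz)
  rw [hinf, ← abs_of_nonneg (dist_nonneg (x := x) (y := m)), ← abs_of_nonneg hl,
    ← Real.cosh_le_cosh, hdm, abs_of_nonneg hl]
  have hs := Real.sinh_nonneg_iff.2 hl
  have hcs := Real.cosh_sq l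
  have hc := Real.cosh_pos l
  constructor
  · intro h
    apply abs_le_of_sq_le_sq _ hs
    nlinarith
  · intro h
    have := sq_le_sq' (abs_le.1 h).1 (abs_le.1 h).2
    refine le_of_abs_le (abs_le_of_sq_le_sq ?_ hc.le)
    nlinarith

lemma frontier_q_ge (a : ℝ) : frontier {x | a ≤ c.q x} = {x | c.q x = a} := by
  apply Subset.antisymm
  · refine (frontier_le_subset_eq continuous_const c.continuous_q).trans fun x hx => ?_
    exact (hx : a = c.q x).symm
  · intro x hx
    have hx' : c.q x = a := hx
    rw [frontier_eq_closure_inter_closure]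
    refine ⟨subset_closure hx'.ge, ?_⟩
    have h1 : ContinuousAt (fun s => c.pt (c.p x) (c.q x - s) (c.p_pos x)) 0 := by
      apply c.continuousAt_of_coord <;> simp <;> fun_prop
    have h2 : c.pt (c.p x) (c.q x - 0) (c.p_pos x) = x := c.ext_point (by simp) (by simp)
    have h3 : Tendsto (fun s => c.pt (c.p x) (c.q x - s) (c.p_pos x)) (nhdsWithin 0 (Ioi 0))
        (nhds x) := by
      rw [ContinuousAt, h2] at h1
      exact h1.mono_left nhdsWithin_le_nhds
    refine mem_closure_of_tendsto h3 ?_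
    filter_upwards [self_mem_nhdsWithin] with s hs
    have : (0 : ℝ) < s := hs
    simp [hx', this]

end Chart

lemma IsHalfspace.exists_chart (c₀ : Chart X) {P : Set X} (hP : IsHalfspace P) :
    ∃ c : Chart X, P = {x | 0 ≤ c.q x} := by
  obtain ⟨σ, hσ, hcl, hun, hint⟩ := hP
  obtain ⟨c, rfl⟩ := hσ.exists_chart c₀
  have himg : ∀ x, x ∈ c.mirror '' P ↔ c.mirror x ∈ P := by
    intro x
    constructor
    · rintro ⟨y, hy, rfl⟩; rwa [c.mirror_mirror]
    · exact fun h => ⟨_, h, c.mirror_mirror x⟩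
  have hun' : ∀ x, x ∈ P ∨ c.mirror x ∈ P := fun x => by
    have : x ∈ P ∪ c.mirror '' P := hun ▸ mem_univ x
    rwa [mem_union, himg] at this
  have hint' : ∀ x, x ∈ P → c.mirror x ∈ P → c.q x = 0 := fun x h1 h2 => by
    have : x ∈ P ∩ c.mirror '' P := ⟨h1, (himg x).2 h2⟩
    rw [hint] at this
    exact (c.mirror_eq_self_iff x).1 this
  have hzero : ∀ x, c.q x = 0 → x ∈ P := fun x hx => by
    have : x ∈ {x | c.mirror x = x} := (c.mirror_eq_self_iff x).2 hx
    rw [← hint] at this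
    exact this.1
  have fin : ∀ d : Chart X, d.mirror = c.mirror → (∀ x, d.q x = 0 ↔ c.q x = 0) →
      (∀ x, 0 < d.q x → x ∈ P) → ∃ c : Chart X, P = {x | 0 ≤ c.q x} := by
    intro d hd h0 h
    refine ⟨d, Subset.antisymm (fun x hx => ?_) fun x hx => ?_⟩
    · by_contra hneg
      have hneg' : d.q x < 0 := not_le.1 hneg
      have h1 := h (d.mirror x) (by simpa using hneg')
      rw [hd] at h1
      have := (h0 x).2 (hint' x hx h1)
      linarith
    · rcases (show 0 ≤ d.q x from hx).eq_or_lt with h1 | h1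
      · exact hzero x ((h0 x).1 h1.symm)
      · exact h x h1
  have hpre := c.isPreconnected_q_preimage (T := Ioi 0) ordConnected_Ioi
  rw [isPreconnected_closed_iff] at hpre
  have h := hpre P (c.mirror ⁻¹' P) hcl (hcl.preimage c.mirror.continuous)
    (fun x _ => hun' x)
  by_cases h1 : ∀ x, 0 < c.q x → x ∈ P
  · exact fin c rfl (fun _ => Iff.rfl) h1
  · push Not at h1
    obtain ⟨y, hy, hyP⟩ := h1
    refine fin c.flip ?_ (fun x => by simp [Chart.flip]) fun x hx => ?_
    · ext x
      refine c.ext_point ?_ ?_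
      · rw [c.p_mirror]; exact c.flip.p_mirror x
      · rw [c.q_mirror]
        have := c.flip.q_mirror x
        simp only [Chart.flip] at this ⊢
        linarith
    · have hx' : c.q x < 0 := by simpa [Chart.flip] using hx
      by_contra hxP
      have hmx : c.mirror x ∈ P := (hun' x).resolve_left hxP
      obtain ⟨z, hz, hz1, hz2⟩ := h ⟨c.mirror x, by simpa using hx', hmx⟩
        ⟨y, hy, (hun' y).resolve_left hyP⟩
      have := hint' z hz1 hz2
      have hz' : 0 < c.q z := hz
      linarith

lemma IsHypercycleOrLine.exists_chart (c₀ : Chart X) {C : Set X} (hC : IsHypercycleOrLine C) :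
    ∃ (c : Chart X) (a : ℝ), C = {x | c.q x = a} := by
  obtain ⟨P, l, hP, hl, rfl⟩ := hC
  obtain ⟨c, rfl⟩ := hP.exists_chart c₀
  refine ⟨c, -Real.sinh l, ?_⟩
  rw [← c.frontier_q_ge]
  congr 1
  ext x
  simp only [mem_ofPred_eq]
  have hs := Real.sinh_nonneg_iff.2 hl
  by_cases hx : 0 ≤ c.q x
  · rw [infDist_zero_of_mem (show x ∈ {x | 0 ≤ c.q x} from hx)]
    exact iff_of_true hl (by linarith)
  · have hx' : c.q x < 0 := not_le.1 hx
    rw [c.infDist_le_iff (S := {x | 0 ≤ c.q x}) (fun z hz => (show c.q z = 0 from hz).ge)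
      (fun z hz => mul_nonpos_of_nonpos_of_nonneg hx'.le hz) hl, abs_of_neg hx']
    constructor <;> intro h <;> linarith

lemma Chart.isParallelDomain (c : Chart X) {b : ℝ} (hb : 0 < b) :
    IsParallelDomain {x | |c.q x| ≤ b} := by
  refine ⟨{x | c.q x = 0}, Real.arsinh b, ?_, Real.arsinh_pos_iff.2 hb, ?_⟩
  · refine ⟨fun t => c.pt (Real.exp (-t)) 0 (Real.exp_pos _), Isometry.of_dist_eq fun s t => ?_, ?_⟩
    · have h : Real.cosh (dist (c.pt (Real.exp (-s)) 0 (Real.exp_pos _))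
          (c.pt (Real.exp (-t)) 0 (Real.exp_pos _))) = Real.cosh (dist s t) := by
        rw [c.cosh_dist, Real.dist_eq, Real.cosh_abs, Real.cosh_eq]
        simp [Real.exp_neg, Real.exp_sub]
        ring
      exact dist_eq_of_cosh_eq h
    · ext x
      constructor
      · intro hx
        exact ⟨-Real.log (c.p x), c.ext_point (by simp [Real.exp_log (c.p_pos x)])
          (by simp [show c.q x = 0 from hx])⟩
      · rintro ⟨t, rfl⟩
        simp
  · ext x
    simp only [parallelDomain, mem_ofPred_eq]
    rw [c.infDist_le_iff Subset.rfl (fun z hz => by simp [show c.q z = 0 from hz])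
      (Real.arsinh_nonneg_iff.2 hb.le), Real.sinh_arsinh]

lemma uniqueBtwPt_of_coord (c : Chart X) {x y w : X} {α β : ℝ} (hα : 0 ≤ α) (hβ : 0 ≤ β)
    (hp : c.p w = α * c.p x + β * c.p y) (hq : c.q w = α * c.q x + β * c.q y)
    (hr : c.r w = α * c.r x + β * c.r y) : UniqueBtwPt x w y := by
  have hx := c.mul_eq x
  have hy := c.mul_eq y
  have hw := c.mul_eq w
  set d := Real.cosh (dist x y) with hd
  have hd1 : 1 ≤ d := Real.one_le_cosh _
  have hd' := c.cosh_dist x y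
  rw [← hd] at hd'
  rw [hp, hq, hr] at hw
  have hnorm : α ^ 2 + β ^ 2 + 2 * α * β * d = 1 := by
    linear_combination hw - α ^ 2 * hx - β ^ 2 * hy + 2 * α * β * hd'
  have hxw : Real.cosh (dist x w) = α + β * d := by
    rw [c.cosh_dist, hp, hq, hr]; linear_combination α * hx - β * hd'
  have hwy : Real.cosh (dist w y) = α * d + β := by
    rw [c.cosh_dist, hp, hq, hr]; linear_combination β * hy - α * hd'
  have hs := Real.cosh_sq (dist x y)
  rw [← hd] at hs
  have hs0 := Real.sinh_nonneg_iff.2 (dist_nonneg (x := x) (y := y))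
  have hsx : Real.sinh (dist x w) = β * Real.sinh (dist x y) := by
    have h1 := Real.cosh_sq (dist x w)
    rw [hxw] at h1
    have h2 := Real.sinh_nonneg_iff.2 (dist_nonneg (x := x) (y := w))
    rw [← sq_eq_sq₀ h2 (by positivity)]
    linear_combination -h1 + β ^ 2 * hs + hnorm
  have hsy : Real.sinh (dist w y) = α * Real.sinh (dist x y) := by
    have h1 := Real.cosh_sq (dist w y)
    rw [hwy] at h1
    have h2 := Real.sinh_nonneg_iff.2 (dist_nonneg (x := w) (y := y))
    rw [← sq_eq_sq₀ h2 (by positivity)]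
    linear_combination -h1 + α ^ 2 * hs + hnorm
  have hbw : dist x w + dist w y = dist x y := by
    have h : Real.cosh (dist x w + dist w y) = Real.cosh (dist x y) := by
      rw [Real.cosh_add, hxw, hwy, hsx, hsy, ← hd]
      linear_combination d * hnorm - α * β * hs
    exact Real.cosh_injOn (mem_Ici.2 (by positivity)) (mem_Ici.2 dist_nonneg) h
  refine ⟨hbw, fun v hv hvw => ?_⟩
  · have hvy : dist v y = dist w y := by
      have : dist x v + dist v y = dist x y := hv
      linarith
    have e1 := congrArg Real.cosh hvw
    have e2 := congrArg Real.cosh hvy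
    have h : Real.cosh (dist v w) = Real.cosh (dist w w) := by
      rw [c.cosh_dist, c.cosh_dist] at e1 e2 ⊢
      rw [hp, hq, hr] at e1 e2 ⊢
      linear_combination α * e1 + β * e2
    have := dist_eq_of_cosh_eq h
    rwa [dist_self, dist_eq_zero] at this

namespace Chart

variable (c : Chart X)

/-- An affine chart (a projective image of the Klein model), with image `{z | z.1 ^ 2 < z.2}`;
geodesic segments become segments. -/
noncomputable def klein (x : X) : ℝ × ℝ := (c.q x / c.p x, c.r x / c.p x)

lemma klein_sub (x : X) : (c.klein x).2 - (c.klein x).1 ^ 2 = (1 / c.p x) ^ 2 := by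
  have := c.p_pos x
  simp only [klein]
  field_simp
  linear_combination c.mul_eq x

lemma continuous_klein : Continuous c.klein :=
  (c.continuous_q.div c.continuous_p fun x => (c.p_pos x).ne').prodMk
    (c.continuous_r.div c.continuous_p fun x => (c.p_pos x).ne')

lemma klein_injective : Function.Injective c.klein := by
  intro x y h
  have h1 := c.klein_sub x
  rw [h, c.klein_sub, sq_eq_sq₀ (one_div_pos.2 (c.p_pos _)).le (one_div_pos.2 (c.p_pos _)).le] at h1
  have h2 : c.p x = c.p y := by simpa using h1.symm
  have h3 := congrArg Prod.fst h
  simp only [klein, h2] at h3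
  exact c.ext_point h2 ((div_left_inj' (c.p_pos y).ne').1 h3)

open Classical in
/-- The inverse of the affine chart. -/
noncomputable def kleinInv (z : ℝ × ℝ) : X :=
  if h : 0 < z.2 - z.1 ^ 2 then
    c.pt (1 / Real.sqrt (z.2 - z.1 ^ 2)) (z.1 / Real.sqrt (z.2 - z.1 ^ 2))
      (one_div_pos.2 (Real.sqrt_pos.2 h))
  else c.pt 1 0 one_pos

lemma p_kleinInv {z : ℝ × ℝ} (h : 0 < z.2 - z.1 ^ 2) :
    c.p (c.kleinInv z) = 1 / Real.sqrt (z.2 - z.1 ^ 2) := by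
  rw [kleinInv, dif_pos h, p_pt]

lemma q_kleinInv {z : ℝ × ℝ} (h : 0 < z.2 - z.1 ^ 2) :
    c.q (c.kleinInv z) = z.1 / Real.sqrt (z.2 - z.1 ^ 2) := by
  rw [kleinInv, dif_pos h, q_pt]

lemma klein_kleinInv {z : ℝ × ℝ} (h : 0 < z.2 - z.1 ^ 2) : c.klein (c.kleinInv z) = z := by
  have hs := Real.sqrt_pos.2 h
  have hs2 := Real.sq_sqrt h.le
  ext
  · simp only [klein, c.p_kleinInv h, c.q_kleinInv h]
    field_simp
  · simp only [klein, c.r_eq, c.p_kleinInv h, c.q_kleinInv h]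
    field_simp
    rw [hs2]; ring

lemma klein_mem (x : X) : 0 < (c.klein x).2 - (c.klein x).1 ^ 2 := by
  rw [klein_sub]
  have := c.p_pos x
  positivity

lemma kleinInv_klein (x : X) : c.kleinInv (c.klein x) = x :=
  c.klein_injective (c.klein_kleinInv (c.klein_mem x))

lemma isOpen_klein_domain : IsOpen {z : ℝ × ℝ | 0 < z.2 - z.1 ^ 2} :=
  isOpen_lt continuous_const (by fun_prop)

lemma continuousOn_kleinInv : ContinuousOn c.kleinInv {z | 0 < z.2 - z.1 ^ 2} := by
  intro z hz
  apply ContinuousAt.continuousWithinAt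
  have hz' : 0 < z.2 - z.1 ^ 2 := hz
  have hs := (Real.sqrt_pos.2 hz').ne'
  have hev : ∀ᶠ w in nhds z, 0 < w.2 - w.1 ^ 2 := isOpen_klein_domain.mem_nhds hz
  apply c.continuousAt_of_coord
  · have : ContinuousAt (fun z : ℝ × ℝ => 1 / Real.sqrt (z.2 - z.1 ^ 2)) z :=
      continuousAt_const.div (by fun_prop) hs
    refine this.congr ?_
    filter_upwards [hev] with w hw
    rw [c.p_kleinInv hw]
  · have : ContinuousAt (fun z : ℝ × ℝ => z.1 / Real.sqrt (z.2 - z.1 ^ 2)) z :=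
      continuousAt_fst.div (by fun_prop) hs
    refine this.congr ?_
    filter_upwards [hev] with w hw
    rw [c.q_kleinInv hw]

lemma isOpenMap_klein : IsOpenMap c.klein := by
  intro U hU
  have h := c.continuousOn_kleinInv.isOpen_inter_preimage isOpen_klein_domain hU
  convert h using 1
  ext z
  constructor
  · rintro ⟨x, hx, rfl⟩
    exact ⟨c.klein_mem x, by simpa [c.kleinInv_klein] using hx⟩
  · rintro ⟨h1, h2⟩
    exact ⟨_, h2, c.klein_kleinInv h1⟩

lemma convex_klein_image {L : Set X} (hL : GConvex L) : Convex ℝ (c.klein '' L) := by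
  rintro _ ⟨x, hx, rfl⟩ _ ⟨y, hy, rfl⟩ a b ha hb hab
  set z := a • c.klein x + b • c.klein y with hz
  have hpx := c.p_pos x
  have hpy := c.p_pos y
  have h1 : z.1 = a * (c.q x / c.p x) + b * (c.q y / c.p y) := by simp [hz, klein]
  have h2 : z.2 = a * (c.r x / c.p x) + b * (c.r y / c.p y) := by simp [hz, klein]
  have hdom : 0 < z.2 - z.1 ^ 2 := by
    have hx' := c.klein_mem x
    have hy' := c.klein_mem y
    simp only [klein] at hx' hy'
    set X₁ := c.q x / c.p x
    set Y₁ := c.q y / c.p y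
    rw [h1, h2]
    have e : b = 1 - a := by linarith
    have hsq : (a * X₁ + b * Y₁) ^ 2 = a * X₁ ^ 2 + b * Y₁ ^ 2 - a * b * (X₁ - Y₁) ^ 2 := by
      rw [e]; ring
    rw [hsq]
    have h3 : 0 ≤ a * b * (X₁ - Y₁) ^ 2 := by positivity
    rcases ha.eq_or_lt with h | h
    · have : b = 1 := by linarith
      rw [← h, this]; nlinarith
    · nlinarith [mul_pos h hx', mul_nonneg hb hy'.le]
  have hs := Real.sqrt_pos.2 hdom
  set s := Real.sqrt (z.2 - z.1 ^ 2) with hs'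
  refine ⟨c.kleinInv z, ?_, c.klein_kleinInv hdom⟩
  refine hL x hx y hy _ (uniqueBtwPt_of_coord c (α := a / (c.p x * s)) (β := b / (c.p y * s))
    (by positivity) (by positivity) ?_ ?_ ?_)
  · rw [c.p_kleinInv hdom, ← hs']
    field_simp
    linarith
  · rw [c.q_kleinInv hdom, ← hs', h1]
    field_simp
  · rw [c.r_eq, c.q_kleinInv hdom, c.p_kleinInv hdom, ← hs']
    have hs2 : s ^ 2 = z.2 - z.1 ^ 2 := Real.sq_sqrt hdom.le
    have : ((z.1 / s) ^ 2 + 1) / (1 / s) = z.2 / s := by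
      field_simp
      rw [hs2]; ring
    rw [this, h2]
    field_simp

end Chart

lemma GConvex.isPreconnected_interior (c : Chart X) {L : Set X} (hL : GConvex L) :
    IsPreconnected (interior L) := by
  have h1 : interior L = c.kleinInv '' interior (c.klein '' L) := by
    have h2 := c.isOpenMap_klein.preimage_interior_eq_interior_preimage c.continuous_klein
      (c.klein '' L)
    rw [c.klein_injective.preimage_image] at h2
    rw [← h2]
    ext x
    constructor
    · exact fun hx => ⟨_, hx, c.kleinInv_klein x⟩
    · rintro ⟨z, hz, rfl⟩
      obtain ⟨y, -, rfl⟩ := interior_subset hz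
      rwa [mem_preimage, c.kleinInv_klein]
  rw [h1]
  refine (c.convex_klein_image hL).interior.isPreconnected.image _
    (c.continuousOn_kleinInv.mono fun z hz => ?_)
  obtain ⟨y, -, rfl⟩ := interior_subset hz
  exact c.klein_mem y

lemma GConvex.subset_closure_interior (c : Chart X) {L : Set X} (hL : GConvex L)
    (hint : (interior L).Nonempty) : L ⊆ closure (interior L) := by
  have h2 := c.isOpenMap_klein.preimage_interior_eq_interior_preimage c.continuous_klein
    (c.klein '' L)
  rw [c.klein_injective.preimage_image] at h2
  rw [← h2, ← c.isOpenMap_klein.preimage_closure_eq_closure_preimage c.continuous_klein]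
  have hne : (interior (c.klein '' L)).Nonempty := by
    obtain ⟨x, hx⟩ := hint
    rw [← h2] at hx
    exact ⟨_, hx⟩
  rw [(c.convex_klein_image hL).closure_interior_eq_closure_of_nonempty_interior hne]
  exact fun x hx => subset_closure (mem_image_of_mem _ hx)

namespace Chart

variable (c : Chart X)

lemma exists_linear_p (d : Chart X) :
    ∃ α β γ : ℝ, ∀ x, d.p x = α * c.p x + β * c.q x + γ * c.r x := by
  set y₁ := d.pt 1 0 one_pos with h1
  set y₂ := d.pt 2 0 two_pos with h2
  refine ⟨4 / 3 * (c.r y₁ - c.r y₂ / 2), 4 / 3 * (-2 * c.q y₁ + c.q y₂),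
    4 / 3 * (c.p y₁ - c.p y₂ / 2), fun x => ?_⟩
  have e : d.p x = 4 / 3 * (2 * Real.cosh (dist x y₁) - Real.cosh (dist x y₂)) := by
    rw [d.cosh_dist, d.cosh_dist, h1, h2]; simp; ring
  rw [e, c.cosh_dist, c.cosh_dist]
  ring

lemma exists_linear_q (d : Chart X) :
    ∃ α β γ : ℝ, ∀ x, d.q x = α * c.p x + β * c.q x + γ * c.r x := by
  obtain ⟨α, β, γ, h⟩ := c.exists_linear_p d
  set y₁ := d.pt 1 0 one_pos with h1
  set y₃ := d.pt 1 1 one_pos with h3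
  refine ⟨α / 2 + (c.r y₁ - c.r y₃) / 2, β / 2 + (- c.q y₁ + c.q y₃),
    γ / 2 + (c.p y₁ - c.p y₃) / 2, fun x => ?_⟩
  have e : d.q x = d.p x / 2 + Real.cosh (dist x y₁) - Real.cosh (dist x y₃) := by
    rw [d.cosh_dist, d.cosh_dist, h1, h3]; simp; ring
  rw [e, h, c.cosh_dist, c.cosh_dist]
  ring

/-- A linear function of the coordinates which is constant along an arc of the horocycle
`p = 1` is a multiple of `p`. -/
lemma coeff_of_const_on_arc {α β γ k a b : ℝ} (hab : a < b)
    (h : ∀ x, c.p x = 1 → c.q x ∈ Ioo a b → α * c.p x + β * c.q x + γ * c.r x = k) :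
    α = k ∧ β = 0 ∧ γ = 0 := by
  have h' : ∀ t ∈ Ioo a b, α + β * t + γ * (t ^ 2 + 1) = k := by
    intro t ht
    have := h (c.pt 1 t one_pos) (by simp) (by simpa using ht)
    simpa using this
  have h1 := h' ((a + b) / 2) ⟨by linarith, by linarith⟩
  have h2 := h' ((a + b) / 2 + (b - a) / 4) ⟨by linarith, by linarith⟩
  have h3 := h' ((a + b) / 2 - (b - a) / 4) ⟨by linarith, by linarith⟩
  have hba : (b - a) ≠ 0 := by linarith
  have hγ : γ = 0 := by
    have : γ * (b - a) ^ 2 = 0 := by linear_combination 8 * (h2 + h3 - 2 * h1)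
    simpa [hba] using this
  subst hγ
  have hβ : β = 0 := by
    have : β * (b - a) = 0 := by linear_combination 4 * (h2 - h1)
    simpa [hba] using this
  subst hβ
  exact ⟨by linarith, rfl, rfl⟩

lemma p_eq_of_const_on_arc {d : Chart X} {a b : ℝ} (hab : a < b)
    (h : ∀ x, c.p x = 1 → c.q x ∈ Ioo a b → d.p x = 1) (x : X) : d.p x = c.p x := by
  obtain ⟨α, β, γ, hl⟩ := c.exists_linear_p d
  obtain ⟨rfl, rfl, rfl⟩ := c.coeff_of_const_on_arc hab fun x h1 h2 => by rw [← hl, h x h1 h2]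
  rw [hl]; ring

lemma not_q_const_on_arc {d : Chart X} {a b k : ℝ} (hab : a < b)
    (h : ∀ x, c.p x = 1 → c.q x ∈ Ioo a b → d.q x = k) : False := by
  obtain ⟨α, β, γ, hl⟩ := c.exists_linear_q d
  obtain ⟨rfl, rfl, rfl⟩ := c.coeff_of_const_on_arc hab fun x h1 h2 => by rw [← hl, h x h1 h2]
  have h0 := hl (d.pt 1 0 one_pos)
  have h1 := hl (d.pt 1 1 one_pos)
  have := c.p_pos (d.pt 1 0 one_pos)
  have hα : α = 0 := by
    have : α * c.p (d.pt 1 0 one_pos) = 0 := by simpa using h0.symm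
    exact (mul_eq_zero.1 this).resolve_right (by linarith)
  simp [hα] at h1

/-- The horocycle `p = 1` as a curve. -/
lemma continuous_horocycle : Continuous fun t => c.pt 1 t one_pos := by
  rw [continuous_iff_continuousAt]
  intro t
  apply c.continuousAt_of_coord <;> simp <;> fun_prop

end Chart

/-- The form in which the symmetry hypothesis on the intersections with a paraball is used. -/
lemma T5Cond1.nontrivial_congruence {K L : Set X} (hcong : T5Cond1 K L) (hK : IsParaball K) (c : Chart X)
    (hint : (interior ({x | c.p x ≤ 1} ∩ L)).Nonempty) :
    AdmitsNontrivialCongruence ({x | c.p x ≤ 1} ∩ L) := by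
  obtain ⟨d, rfl⟩ := hK.exists_chart c
  obtain ⟨φ, hφ, himg⟩ := d.exists_orientationPreserving c
  have hid : ⇑(IsometryEquiv.refl X) '' L = L := image_id L
  have h := hcong φ (IsometryEquiv.refl X) hφ orientationPreserving_refl
  rw [himg, hid] at h
  exact h hint

namespace Chart

variable (c : Chart X)

lemma continuous_vertical (u : X) :
    ContinuousAt (fun s => c.pt (c.p u * Real.exp s) (c.q u)
      (mul_pos (c.p_pos u) (Real.exp_pos s))) 0 := by
  apply c.continuousAt_of_coord <;> simp <;> fun_prop

lemma vertical_zero (u : X) :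
    c.pt (c.p u * Real.exp 0) (c.q u) (mul_pos (c.p_pos u) (Real.exp_pos 0)) = u :=
  c.ext_point (by simp) (by simp)

lemma interior_inter_nonempty {L : Set X} {u : X} (hu : u ∈ interior L) (hpu : c.p u = 1) :
    (interior ({x | c.p x ≤ 1} ∩ L)).Nonempty := by
  have h1 := c.continuous_vertical u
  rw [ContinuousAt, c.vertical_zero] at h1
  have h2 := h1.mono_left (nhdsWithin_le_nhds (s := Iio 0))
  obtain ⟨s, hs1, hs2⟩ := ((h2.eventually (isOpen_interior.mem_nhds hu)).and
    self_mem_nhdsWithin).exists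
  refine ⟨_, mem_interior.2 ⟨{x | c.p x < 1} ∩ interior L, ?_, ?_, ?_, hs1⟩⟩
  · exact inter_subset_inter (fun x hx => (show c.p x < 1 from hx).le) interior_subset
  · exact (isOpen_lt c.continuous_p continuous_const).inter isOpen_interior
  · have : s < 0 := hs2
    simp [hpu, this]

lemma mem_frontier_inter {L : Set X} {u : X} (hu : u ∈ L) (hpu : c.p u = 1) :
    u ∈ frontier ({x | c.p x ≤ 1} ∩ L) := by
  rw [frontier_eq_closure_inter_closure]
  refine ⟨subset_closure ⟨hpu.le, hu⟩, ?_⟩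
  have h1 := c.continuous_vertical u
  rw [ContinuousAt, c.vertical_zero] at h1
  have h2 := h1.mono_left (nhdsWithin_le_nhds (s := Ioi 0))
  refine mem_closure_of_tendsto h2 ?_
  filter_upwards [self_mem_nhdsWithin] with s hs
  have : 0 < s := hs
  rintro ⟨h, -⟩
  simp only [mem_ofPred_eq, p_pt, hpu, one_mul, Real.exp_le_one_iff] at h
  linarith

lemma mem_frontier_inter_imp {L : Set X} {x : X} (h : x ∈ frontier ({x | c.p x ≤ 1} ∩ L)) :
    c.p x = 1 ∨ x ∈ frontier L := by
  rcases frontier_inter_subset _ _ h with h | h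
  · exact Or.inl (frontier_le_subset_eq c.continuous_p continuous_const h.1)
  · exact Or.inr h.2

/-- A non-trivial congruence of the intersection of a paraball and `L` preserves the paraball,
as soon as the bounding horocycle meets the interior of `L`. -/
lemma exists_congruence {K L : Set X} (hcong : T5Cond1 K L) (hK : IsParaball K)
    (hLcl : IsClosed L) (hLbd : BdryHypOrLine L) {u : X} (hu : u ∈ interior L)
    (hpu : c.p u = 1) :
    ∃ f : X ≃ᵢ X, f ≠ IsometryEquiv.refl X ∧ (∀ x, c.p (f x) = c.p x) ∧
      ∀ x, c.p x ≤ 1 → x ∈ L → f x ∈ L := by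
  obtain ⟨f, hf, himg⟩ := hcong.nontrivial_congruence hK c (c.interior_inter_nonempty hu hpu)
  refine ⟨f, hf, ?_, fun x h1 h2 => (himg.subset (mem_image_of_mem f ⟨h1, h2⟩)).2⟩
  have hfr : ∀ x, c.p x = 1 → x ∈ L → c.p (f x) = 1 ∨ f x ∈ frontier L := by
    intro x hx hxL
    apply c.mem_frontier_inter_imp
    rw [← himg, ← f.coe_toHomeomorph, ← f.toHomeomorph.image_frontier]
    exact mem_image_of_mem _ (c.mem_frontier_inter hxL hx)
  have hfL : ∀ x, c.p x = 1 → x ∈ L → f x ∈ L := fun x h1 h2 =>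
    (himg.subset (mem_image_of_mem f ⟨h1.le, h2⟩)).2
  have hpt : ∀ x, c.p x = 1 → c.pt 1 (c.q x) one_pos = x := fun x hx =>
    c.ext_point (by simp [hx]) (by simp)
  -- an arc of the horocycle inside an open set
  have harc : ∀ (U : Set X) (v : X), IsOpen U → v ∈ U → c.p v = 1 →
      ∃ a b, a < b ∧ c.q v ∈ Ioo a b ∧ ∀ t ∈ Ioo a b, c.pt 1 t one_pos ∈ U := by
    intro U v hU hv hpv
    have h : (fun t => c.pt 1 t one_pos) ⁻¹' U ∈ nhds (c.q v) :=
      (hU.preimage c.continuous_horocycle).mem_nhds (by rwa [mem_preimage, hpt v hpv])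
    obtain ⟨a, b, hab, hsub⟩ := mem_nhds_iff_exists_Ioo_subset.1 h
    exact ⟨a, b, hab.1.trans hab.2, hab, hsub⟩
  obtain ⟨a, b, hab, hub, hsub⟩ := harc _ u isOpen_interior hu hpu
  by_cases hA : ∃ t ∈ Ioo a b, f (c.pt 1 t one_pos) ∉ frontier L
  · obtain ⟨t, ht, htf⟩ := hA
    have hmem : c.pt 1 t one_pos ∈ interior L ∩ f ⁻¹' interior L := by
      refine ⟨hsub t ht, ?_⟩
      have h1 := hfL (c.pt 1 t one_pos) (by simp) (interior_subset (hsub t ht))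
      rw [hLcl.frontier_eq] at htf
      by_contra h2
      exact htf ⟨h1, h2⟩
    obtain ⟨a', b', hab', -, hsub'⟩ := harc _ _
      (isOpen_interior.inter (isOpen_interior.preimage f.continuous)) hmem (by simp)
    refine c.p_eq_of_const_on_arc (d := c.comp f) hab' fun x hx hqx => ?_
    have h3 := hsub' _ hqx
    rw [hpt x hx] at h3
    refine (hfr x hx (interior_subset h3.1)).resolve_right fun h4 => ?_
    rw [hLcl.frontier_eq] at h4
    exact h4.2 h3.2
  · exfalso
    push Not at hA
    set z := f (c.pt 1 (c.q u) one_pos) with hz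
    obtain ⟨d, k, hd⟩ := (hLbd z (hA _ hub)).exists_chart c
    have hpre : IsPreconnected ((fun t => f (c.pt 1 t one_pos)) '' Ioo a b) :=
      isPreconnected_Ioo.image _ (f.continuous.comp c.continuous_horocycle).continuousOn
    have hsubset := hpre.subset_connectedComponentIn (mem_image_of_mem _ hub)
      (by rintro _ ⟨t, ht, rfl⟩; exact hA t ht)
    refine c.not_q_const_on_arc (d := d.comp f) (k := k) hab fun x hx hqx => ?_
    have h := hsubset (mem_image_of_mem _ hqx)
    simp only [hpt x hx] at h
    rw [← hz] at h
    have h' : f x ∈ {x | d.q x = k} := hd ▸ h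
    exact h'

end Chart

namespace Chart

variable (c : Chart X)

lemma horofunction_identity {c₀ s t : ℝ} (hs : s ^ 2 = c₀ ^ 2 + 1) (x : X) :
    c.p x * (c.r x + 2 * t * c.q x + t ^ 2 * c.p x - 2 * t * (s + c₀)) =
      (t * c.p x - s + (c.q x - c₀)) ^ 2 + 2 * (c.q x - c₀) * (c₀ + s) := by
  linear_combination c.mul_eq x - hs

lemma exists_mem_of_symmetry {K L : Set X} (hcong : T5Cond1 K L) (hK : IsParaball K)
    (hLcl : IsClosed L) (hLbd : BdryHypOrLine L) {c₀ : ℝ} (hL : ∀ x ∈ L, c₀ ≤ c.q x)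
    (hC : ∀ x, c.q x = c₀ → x ∈ L)
    {u : X} (hu : u ∈ interior L) {t : ℝ} (ht : 0 < t) :
    ∃ w ∈ L, t * c.p w = c.r u / t ∧ c.q w = c.q u := by
  obtain ⟨s, hs0, hs⟩ : ∃ s : ℝ, 0 < s ∧ s ^ 2 = c₀ ^ 2 + 1 :=
    ⟨Real.sqrt (c₀ ^ 2 + 1), Real.sqrt_pos.2 (by positivity), Real.sq_sqrt (by positivity)⟩
  have hsc : 0 < c₀ + s := by nlinarith
  set e : Chart X := (c.shift t).swap with he
  have hep : ∀ x, e.p x = c.r x + 2 * t * c.q x + t ^ 2 * c.p x := fun x => rfl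
  set d : Chart X := e.scale (1 / e.p u) (one_div_pos.2 (e.p_pos u)) with hd
  have hdp : ∀ x, d.p x = 1 / e.p u * e.p x := fun x => rfl
  have hdu : d.p u = 1 := by rw [hdp, one_div_mul_cancel (e.p_pos u).ne']
  obtain ⟨f, hf, hfp, hfL⟩ := d.exists_congruence hcong hK hLcl hLbd hu hdu
  have hfe : ∀ x, e.p (f x) = e.p x := fun x => by
    have h := hfp x
    rw [hdp, hdp] at h
    exact mul_left_cancel₀ (one_div_pos.2 (e.p_pos u)).ne' h
  -- the touching point of the horocycle family
  set v := c.pt (s / t) c₀ (by positivity) with hv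
  have hvL : v ∈ L := hC _ (by simp [hv])
  have hev : e.p v = 2 * t * (s + c₀) := by
    have h1 : c.p v = s / t := by simp [hv]
    have h := c.horofunction_identity (t := t) hs v
    rw [← hep, h1, show c.q v = c₀ by simp [hv], mul_div_cancel₀ _ ht.ne'] at h
    have h2 : s / t * (e.p v - 2 * t * (s + c₀)) = 0 := by rw [h]; ring
    have h3 := (mul_eq_zero.1 h2).resolve_left (by positivity)
    linarith
  have hmin : ∀ x ∈ L, e.p v ≤ e.p x := fun x hx => by
    have h := c.horofunction_identity (t := t) hs x
    rw [← hep, ← hev] at h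
    have h2 : 0 ≤ c.p x * (e.p x - e.p v) := by
      rw [h]
      have := sub_nonneg.2 (hL x hx)
      positivity
    have := nonneg_of_mul_nonneg_right h2 (c.p_pos x)
    linarith
  have hfvL : f v ∈ L := by
    refine hfL v ?_ hvL
    rw [← hdu, hdp, hdp]
    exact mul_le_mul_of_nonneg_left (hmin u (interior_subset hu)) (one_div_pos.2 (e.p_pos u)).le
  have hfv : f v = v := by
    have h := c.horofunction_identity (t := t) hs (f v)
    rw [← hep, ← hev, hfe, sub_self, mul_zero] at h
    have h0 := sub_nonneg.2 (hL _ hfvL)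
    have h1 : 0 ≤ 2 * (c.q (f v) - c₀) * (c₀ + s) := by positivity
    have h2 : 2 * (c.q (f v) - c₀) * (c₀ + s) = 0 := by
      nlinarith [sq_nonneg (t * c.p (f v) - s + (c.q (f v) - c₀))]
    have h3 : c.q (f v) - c₀ = 0 := by
      have := (mul_eq_zero.1 h2).resolve_right hsc.ne'
      linarith
    rw [h3] at h
    have h4 : t * c.p (f v) - s = 0 := by
      have : (t * c.p (f v) - s) ^ 2 = 0 := by linear_combination -h
      simpa using this
    refine c.ext_point ?_ ?_
    · rw [hv, p_pt, eq_div_iff ht.ne']; linarith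
    · rw [hv, q_pt]; linarith
  have hq : ∀ x, c.q (f x) = c.q x := fun x => by
    have h1 := c.cosh_dist (f x) v
    have h2 := c.cosh_dist x v
    have h3 : dist (f x) v = dist x v := by
      conv_lhs => rw [← hfv]
      exact f.dist_eq _ _
    rw [h3, h2] at h1
    have h4 := hfe x
    rw [hep, hep] at h4
    have hr : c.r v = s * t := by
      rw [c.r_eq, hv, p_pt, q_pt, ← hs]; field_simp
    rw [hr, show c.p v = s / t by simp [hv], show c.q v = c₀ by simp [hv]] at h1
    field_simp at h1
    have h5 : 2 * t * (c₀ + s) * (c.q (f x) - c.q x) = 0 := by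
      linear_combination h1 + s * h4
    have := (mul_eq_zero.1 h5).resolve_left (by positivity)
    linarith
  have hpr : ∀ x, t * c.p (f x) + c.r (f x) / t = t * c.p x + c.r x / t := fun x => by
    have h4 := hfe x
    rw [hep, hep, hq] at h4
    field_simp
    linear_combination h4
  have hm := (c.scale t ht).perp.eq_refl_or_mirror (f := f)
    (fun x => by
      have := hpr x
      have h2 := hq x
      rw [p_perp, p_perp]
      change (t * c.p (f x) + c.r (f x) / t) / 2 + c.q (f x) = (t * c.p x + c.r x / t) / 2 + c.q x
      rw [this, h2])
    (fun x => by
      have := hpr x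
      have h2 := hq x
      rw [r_perp, r_perp]
      change (t * c.p (f x) + c.r (f x) / t) / 2 - c.q (f x) = (t * c.p x + c.r x / t) / 2 - c.q x
      rw [this, h2])
  have hm' := hm.resolve_left hf
  refine ⟨f u, hfL u hdu.le (interior_subset hu), ?_, hq u⟩
  rw [hm']
  exact (c.scale t ht).p_mirror_perp u

lemma mem_of_q_eq {K L : Set X} (hcong : T5Cond1 K L) (hK : IsParaball K)
    (hLcl : IsClosed L) (hLbd : BdryHypOrLine L) {c₀ : ℝ} (hL : ∀ x ∈ L, c₀ ≤ c.q x)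
    (hC : ∀ x, c.q x = c₀ → x ∈ L)
    {u : X} (hu : u ∈ interior L) {x : X} (hx : c.q x = c.q u) : x ∈ L := by
  have h0 : 0 < c.r u / c.p x := div_pos (c.r_pos u) (c.p_pos x)
  obtain ⟨w, hw, hp, hq⟩ := c.exists_mem_of_symmetry hcong hK hLcl hLbd hL hC hu
    (Real.sqrt_pos.2 h0)
  have hs := Real.sq_sqrt h0.le
  have hs0 := Real.sqrt_pos.2 h0
  have h1 : c.p w = c.p x := by
    have hpx := (c.p_pos x).ne'
    have hru := (c.r_pos u).ne'
    rw [eq_div_iff hs0.ne'] at hp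
    have h2 : c.r u / c.p x * c.p w = c.r u := by rw [← hs]; linear_combination hp
    field_simp at h2
    exact h2
  rwa [← c.ext_point h1 (hq.trans hx.symm)]

lemma eq_q_preimage {K L : Set X} (hcong : T5Cond1 K L) (hK : IsParaball K)
    (hLcl : IsClosed L) (hLbd : BdryHypOrLine L) {c₀ : ℝ} 
    (hLi : ∀ u ∈ interior L, c₀ < c.q u) (hL : ∀ x ∈ L, c₀ ≤ c.q x)
    (hC : ∀ x, c.q x = c₀ → x ∈ L)
    (hLcv : GConvex L) (hLint : (interior L).Nonempty) :
    ∃ T : Set ℝ, IsClosed T ∧ T.OrdConnected ∧ c₀ ∈ T ∧ (∀ t ∈ T, c₀ ≤ t) ∧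
      (∃ t ∈ T, c₀ < t) ∧ L = {x | c.q x ∈ T} := by
  have hLsub := hLcv.subset_closure_interior c hLint
  have hLT : ∀ x ∈ L, c.q x ∈ closure (c.q '' interior L) := fun x hx =>
    image_closure_subset_closure_image c.continuous_q (mem_image_of_mem _ (hLsub hx))
  refine ⟨closure (c.q '' interior L), isClosed_closure, ?_, ?_, ?_, ?_, ?_⟩
  · exact ((hLcv.isPreconnected_interior c).image _
      c.continuous_q.continuousOn).closure.ordConnected
  · simpa using hLT (c.pt 1 c₀ one_pos) (hC _ (by simp))
  · intro t ht
    refine closure_minimal ?_ isClosed_Ici ht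
    rintro _ ⟨u, hu, rfl⟩
    exact (hLi u hu).le
  · obtain ⟨u, hu⟩ := hLint
    exact ⟨c.q u, subset_closure (mem_image_of_mem _ hu), hLi u hu⟩
  · refine Subset.antisymm hLT fun x hx => ?_
    have hcont : Continuous fun t => c.pt (c.p x) t (c.p_pos x) := by
      rw [continuous_iff_continuousAt]
      intro t
      apply c.continuousAt_of_coord <;> simp <;> fun_prop
    have hsub : closure (c.q '' interior L) ⊆ (fun t => c.pt (c.p x) t (c.p_pos x)) ⁻¹' L := by
      refine closure_minimal ?_ (hLcl.preimage hcont)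
      rintro _ ⟨u, hu, rfl⟩
      exact c.mem_of_q_eq hcong hK hLcl hLbd hL hC hu (by simp)
    have h := hsub hx
    rwa [mem_preimage, show c.pt (c.p x) (c.q x) (c.p_pos x) = x from
      c.ext_point (by simp) (by simp)] at h

lemma dist_horocycle {x y : X} {h : ℝ} (hx : c.p x = h) (hy : c.p y = h) :
    2 * (Real.cosh (dist x y) - 1) = (c.q x - c.q y) ^ 2 := by
  have h1 := c.mul_eq x
  have h2 := c.mul_eq y
  rw [c.cosh_dist]
  rw [hx] at h1
  rw [hy] at h2
  rw [hx, hy]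
  linear_combination h1 + h2

/-- A congruence which preserves the horocycle at height `h` and maps the points with second
coordinate in `[a, b]` on it to such points fixes or swaps its two endpoints. -/
lemma fixes_or_swaps {f : X ≃ᵢ X} (hfp : ∀ x, c.p (f x) = c.p x) {a b h : ℝ} (hab : a < b)
    {x y : X} (hx : c.p x = h) (hy : c.p y = h) (hqx : c.q x = a) (hqy : c.q y = b)
    (hfx : c.q (f x) ∈ Icc a b) (hfy : c.q (f y) ∈ Icc a b) :
    (f x = x ∧ f y = y) ∨ (f x = y ∧ f y = x) := by
  have h1 := c.dist_horocycle hx hy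
  have h2 := c.dist_horocycle ((hfp x).trans hx) ((hfp y).trans hy)
  rw [f.dist_eq, h1, hqx, hqy] at h2
  have hba : 0 < b - a := sub_pos.2 hab
  rcases sq_eq_sq_iff_eq_or_eq_neg.1 h2 with h3 | h3
  · left
    constructor <;> refine c.ext_point (by simp [hfp]) ?_ <;> linarith [hfx.1, hfx.2, hfy.1, hfy.2]
  · right
    constructor <;> refine c.ext_point (by simp [hfp, hx, hy]) ?_ <;>
      linarith [hfx.1, hfx.2, hfy.1, hfy.2]

lemma eq_refl_of_fixes {f : X ≃ᵢ X} (hfp : ∀ x, c.p (f x) = c.p x) {h : ℝ} {x y : X}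
    (hx : c.p x = h) (hy : c.p y = h) (hq : c.q x ≠ c.q y) (hfx : f x = x) (hfy : f y = y) :
    f = IsometryEquiv.refl X := by
  refine IsometryEquiv.ext fun z => c.ext_point (hfp z) ?_
  have key : ∀ w, f w = w → (c.p z * c.r w + c.r (f z) * c.p w) / 2 - c.q (f z) * c.q w =
      (c.p z * c.r w + c.r z * c.p w) / 2 - c.q z * c.q w := by
    intro w hw
    have h1 := c.cosh_dist (f z) w
    rw [show dist (f z) w = dist z w by conv_lhs => rw [← hw, f.dist_eq], c.cosh_dist, hfp] at h1
    exact h1.symm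
  have h1 := key x hfx
  have h2 := key y hfy
  rw [hx] at h1
  rw [hy] at h2
  have h3 : (c.q x - c.q y) * (c.q (f z) - c.q z) = 0 := by linear_combination h2 - h1
  exact sub_eq_zero.1 ((mul_eq_zero.1 h3).resolve_left (sub_ne_zero.2 hq))

lemma cosh_dist_half {x y : X} (hx : c.p x = 1) (hy : c.p y = 1 / 2) :
    Real.cosh (dist x y) = (c.q y - c.q x / 2) ^ 2 + 5 / 4 := by
  have h1 := c.mul_eq x
  have h2 := c.mul_eq y
  rw [c.cosh_dist]
  rw [hx] at h1
  rw [hy] at h2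
  rw [hx, hy]
  linear_combination h1 / 4 + h2

/-- A strip between two distance curves, whose intersection with a horoball around an endpoint
of the base line has a non-trivial symmetry, is symmetric with respect to the base line. -/
lemma strip_symmetric {f : X ≃ᵢ X} (hf : f ≠ IsometryEquiv.refl X)
    (hfp : ∀ x, c.p (f x) = c.p x) {a b : ℝ} (hab : a < b)
    (hfq : ∀ x, c.p x ≤ 1 → c.q x ∈ Icc a b → c.q (f x) ∈ Icc a b) : a = -b := by
  obtain ⟨A, hA, hA'⟩ := c.surj 1 a one_pos
  obtain ⟨B, hB, hB'⟩ := c.surj 1 b one_pos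
  obtain ⟨A₂, hA₂, hA₂'⟩ := c.surj (1 / 2) a (by norm_num)
  obtain ⟨B₂, hB₂, hB₂'⟩ := c.surj (1 / 2) b (by norm_num)
  have ma : a ∈ Icc a b := ⟨le_rfl, hab.le⟩
  have mb : b ∈ Icc a b := ⟨hab.le, le_rfl⟩
  have h1 := c.fixes_or_swaps hfp hab hA hB hA' hB'
    (hfq A hA.le (hA' ▸ ma)) (hfq B hB.le (hB' ▸ mb))
  have h2 := c.fixes_or_swaps hfp hab hA₂ hB₂ hA₂' hB₂'
    (hfq A₂ (by rw [hA₂]; norm_num) (hA₂' ▸ ma)) (hfq B₂ (by rw [hB₂]; norm_num) (hB₂' ▸ mb))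
  rcases h1 with ⟨h3, h4⟩ | ⟨h3, h4⟩
  · exact absurd (c.eq_refl_of_fixes hfp hA hB (by rw [hA', hB']; exact hab.ne) h3 h4) hf
  have e1 := f.dist_eq A A₂
  have e2 := f.dist_eq B B₂
  rw [h3] at e1
  rw [h4] at e2
  have hba : b - a ≠ 0 := (sub_pos.2 hab).ne'
  rcases h2 with ⟨h5, h6⟩ | ⟨h5, h6⟩
  · rw [h5] at e1
    rw [h6] at e2
    have e1 := congrArg Real.cosh e1
    have e2 := congrArg Real.cosh e2
    rw [c.cosh_dist_half hB hA₂, c.cosh_dist_half hA hA₂, hA', hB', hA₂'] at e1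
    rw [c.cosh_dist_half hA hB₂, c.cosh_dist_half hB hB₂, hA', hB', hB₂'] at e2
    have g1 : (b - a) * (b - 3 * a) = 0 := by linear_combination 4 * e1
    have g2 : (b - a) * (3 * b - a) = 0 := by linear_combination 4 * e2
    have g1' := (mul_eq_zero.1 g1).resolve_left hba
    have g2' := (mul_eq_zero.1 g2).resolve_left hba
    linarith
  · rw [h5] at e1
    have e1 := congrArg Real.cosh e1
    rw [c.cosh_dist_half hB hB₂, c.cosh_dist_half hA hA₂, hA', hB', hA₂', hB₂'] at e1
    have g1 : (b - a) * (b + a) = 0 := by linear_combination 4 * e1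
    have g1' := (mul_eq_zero.1 g1).resolve_left hba
    linarith

lemma isParallelDomain_of_two_components {K L : Set X} (hcong : T5Cond1 K L) (hK : IsParaball K)
    (hLcl : IsClosed L) (hLcv : GConvex L) (hLint : (interior L).Nonempty)
    (hLbd : BdryHypOrLine L) (hLtwo : AtLeastTwoComponents L) {c₀ : ℝ}
    (hLi : ∀ u ∈ interior L, c₀ < c.q u) (hC : ∀ x, c.q x = c₀ → x ∈ L) :
    IsParallelDomain L := by
  have hL : ∀ x ∈ L, c₀ ≤ c.q x := fun x hx =>
    closure_minimal (fun u hu => (hLi u hu).le) (isClosed_le continuous_const c.continuous_q)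
      (hLcv.subset_closure_interior c hLint hx)
  obtain ⟨T, hTcl, hTo, hT0, hTle, ⟨t, htT, ht⟩, hLT⟩ :=
    c.eq_q_preimage hcong hK hLcl hLbd hLi hL hC hLcv hLint
  by_cases hb : BddAbove T
  · have hbT := hTcl.csSup_mem ⟨_, hT0⟩ hb
    set b := sSup T with hbdef
    have hTI : T = Icc c₀ b :=
      Subset.antisymm (fun s hs => ⟨hTle s hs, le_csSup hb hs⟩) (hTo.out hT0 hbT)
    have hab : c₀ < b := ht.trans_le (le_csSup hb htT)
    rw [hTI] at hLT
    obtain ⟨u, hu, hu'⟩ := c.surj 1 ((c₀ + b) / 2) one_pos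
    have hui : u ∈ interior L := by
      refine mem_interior.2 ⟨c.q ⁻¹' Ioo c₀ b, ?_, isOpen_Ioo.preimage c.continuous_q, ?_⟩
      · rw [hLT]
        exact fun x hx => Ioo_subset_Icc_self hx
      · rw [mem_preimage, hu']
        constructor <;> linarith
    obtain ⟨f, hf, hfp, hfL⟩ := c.exists_congruence hcong hK hLcl hLbd hui hu
    have h := c.strip_symmetric hf hfp hab fun x h1 h2 => by
      have h3 := hfL x h1 (hLT ▸ h2)
      rw [hLT] at h3
      exact h3
    have hb0 : 0 < b := by linarith
    convert c.isParallelDomain hb0 using 1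
    rw [hLT, h]
    ext x
    exact abs_le.symm
  · exfalso
    have hTI : T = Ici c₀ := by
      refine Subset.antisymm (fun s hs => hTle s hs) fun s hs => ?_
      rw [not_bddAbove_iff] at hb
      obtain ⟨s', hs', hlt⟩ := hb s
      exact hTo.out hT0 hs' ⟨hs, hlt.le⟩
    have hfr : frontier L = {x | c.q x = c₀} := by
      rw [hLT, hTI]
      exact c.frontier_q_ge c₀
    have hpre : IsPreconnected (frontier L) := by
      rw [hfr]
      exact c.isPreconnected_q_preimage (T := {c₀}) ordConnected_singleton
    obtain ⟨x, hx, y, hy, hne⟩ := hLtwo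
    exact hne (by rw [hpre.connectedComponentIn hx, hpre.connectedComponentIn hy])

end Chart

/-- **Lemma 5.5.** In the hyperbolic plane, suppose every intersection of congruent
copies of `K`, `L` admits some non-trivial congruence, `K` is a paracircle (paraball),
and the connected boundary components of `L` are at least two hypercycles or straight
lines. Then case (D) holds: `L` is the parallel domain of some straight line, at some
distance `l > 0`. -/
theorem lemma5_5
    (X : Type*) [MetricSpace X] (hX : IsHyperbolicSpace X 2)
    (K L : Set X)
    (hKcl : IsClosed K) (hLcl : IsClosed L)
    (hKcv : GConvex K) (hLcv : GConvex L)
    (hKint : (interior K).Nonempty) (hLint : (interior L).Nonempty)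
    (hKpr : K ≠ univ) (hLpr : L ≠ univ)
    (hcong : T5Cond1 K L)
    (hK : IsParaball K)
    (hLbd : BdryHypOrLine L) (hLtwo : AtLeastTwoComponents L) :
    IsParallelDomain L := by
  obtain ⟨c₁⟩ := exists_chart hX
  obtain ⟨x, hx, -⟩ := id hLtwo
  obtain ⟨c, a, hc⟩ := (hLbd x hx).exists_chart c₁
  have hfr : ∀ y, c.q y = a → y ∈ frontier L := fun y hy =>
    connectedComponentIn_subset _ _ (hc ▸ (show y ∈ {z | c.q z = a} from hy))
  have hC : ∀ y, c.q y = a → y ∈ L := fun y hy => hLcl.frontier_subset (hfr y hy)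
  have hne : ∀ u ∈ interior L, c.q u ≠ a := fun u hu h => (hLcl.frontier_eq ▸ hfr u h).2 hu
  have hoc : (c.q '' interior L).OrdConnected :=
    ((hLcv.isPreconnected_interior c).image _ c.continuous_q.continuousOn).ordConnected
  obtain ⟨u₀, hu₀⟩ := id hLint
  rcases lt_or_gt_of_ne (hne u₀ hu₀) with h | h
  · refine c.flip.isParallelDomain_of_two_components hcong hK hLcl hLcv hLint hLbd hLtwo
      (c₀ := -a) (fun u hu => ?_) (fun y hy => hC y (neg_injective hy))
    refine neg_lt_neg (lt_of_not_ge fun hle => ?_)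
    obtain ⟨w, hw, hwa⟩ := hoc.out (mem_image_of_mem _ hu₀) (mem_image_of_mem _ hu) ⟨h.le, hle⟩
    exact hne w hw hwa
  · refine c.isParallelDomain_of_two_components hcong hK hLcl hLcv hLint hLbd hLtwo
      (c₀ := a) (fun u hu => lt_of_not_ge fun hle => ?_) hC
    obtain ⟨w, hw, hwa⟩ := hoc.out (mem_image_of_mem _ hu) (mem_image_of_mem _ hu₀) ⟨hle, h.le⟩
    exact hne w hw hwa

end BallChar
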